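/- There exist Δ¹₁ (lightface Borel) sets B, C ⊆ [ℕ]^ℕ such that χ_B(G_S|_C) = ℵ₀, the graph G_S|_B admits no finite coloring by Δ¹₁ sets, yet the product graph G_S|_B × G_S|_C admits a 3-coloring by Δ¹₁ sets. In particular, the Δ¹₁ version of Hedetniemi's conjecture fails. -/

import Mathlib

open MeasureTheory Set

/-- The Baire space `ℕ^ℕ`. -/
abbrev NN : Type := ℕ → ℕ

/-- The space `[ℕ]^ℕ` of infinite subsets of `ℕ`, identified with their increasing
enumerations, with the topology inherited from `ℕ^ℕ`. -/
abbrev IncSeq : Type := {x : NN // StrictMono x}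

/-- The shift map `S(x) = x \ {min x}`. -/
def shift (x : IncSeq) : IncSeq :=
  ⟨fun n => x.1 (n + 1), fun _ _ h => x.2 (Nat.add_lt_add_right h 1)⟩

/-- The edge relation of the shift graph `G_S` on `[ℕ]^ℕ`. -/
def shiftEdge (x y : IncSeq) : Prop := x ≠ y ∧ (shift x = y ∨ shift y = x)

/-- `G_S|_B` admits a Borel coloring with `n` colors. -/
def BorelColoringLE (B : Set IncSeq) (n : ℕ) : Prop :=
  ∃ c : B → Fin n, Measurable c ∧ ∀ x y : B, shiftEdge x.1 y.1 → c x ≠ c y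

/-- Lightface `Σ¹₁` subsets of Baire space: projections along `ℕ^ℕ` of recursive trees. -/
def SigmaLight (A : Set NN) : Prop :=
  ∃ f : List ℕ → Bool, Computable f ∧
    A = {x : NN | ∃ y : NN, ∀ n : ℕ,
      f ((List.range n).map fun i => Nat.pair (x i) (y i)) = true}

/-- Lightface `Σ¹₁` subsets of `ℕ^ℕ × ℕ^ℕ`. -/
def SigmaLight2 (A : Set (NN × NN)) : Prop :=
  ∃ f : List ℕ → Bool, Computable f ∧
    A = {x : NN × NN | ∃ y : NN, ∀ n : ℕ,
      f ((List.range n).map fun i => Nat.pair (x.1 i) (Nat.pair (x.2 i) (y i))) = true}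

/-- A subset of `[ℕ]^ℕ` is (lightface) `Δ¹₁` if both it and its complement in `[ℕ]^ℕ`
are lightface `Σ¹₁` (as subsets of `ℕ^ℕ`). -/
def LightDelta11 (S : Set IncSeq) : Prop :=
  SigmaLight (Subtype.val '' S) ∧ SigmaLight (Subtype.val '' Sᶜ)

/-- A subset of `[ℕ]^ℕ × [ℕ]^ℕ` is (lightface) `Δ¹₁` if both it and its complement are
lightface `Σ¹₁`. -/
def LightDelta11P (S : Set (IncSeq × IncSeq)) : Prop :=
  SigmaLight2 ((fun p : IncSeq × IncSeq => (p.1.1, p.2.1)) '' S) ∧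
  SigmaLight2 ((fun p : IncSeq × IncSeq => (p.1.1, p.2.1)) '' Sᶜ)

/-- `G_S|_B` admits a coloring by `n` `Δ¹₁` sets. -/
def DeltaColoringLE (B : Set IncSeq) (n : ℕ) : Prop :=
  ∃ A : Fin n → Set IncSeq, (∀ i, LightDelta11 (A i)) ∧ B ⊆ (⋃ i, A i) ∧
    ∀ i, ∀ y ∈ A i ∩ B, ∀ z ∈ A i ∩ B, ¬ shiftEdge y z

section PrimrecRules

attribute [fun_prop] Primrec Primrec.id Primrec.const

variable {α β γ σ : Type*} [Primcodable α] [Primcodable β] [Primcodable γ] [Primcodable σ]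

namespace PrimrecRule

@[fun_prop] theorem comp {f : β → σ} {g : α → β} (hf : Primrec f) (hg : Primrec g) :
    Primrec fun a => f (g a) := hf.comp hg

@[fun_prop] theorem pair {f : α → β} {g : α → γ} (hf : Primrec f) (hg : Primrec g) :
    Primrec fun a => (f a, g a) := hf.pair hg

@[fun_prop] theorem fst {f : α → β × γ} (hf : Primrec f) : Primrec fun a => (f a).1 :=
  Primrec.fst.comp hf

@[fun_prop] theorem snd {f : α → β × γ} (hf : Primrec f) : Primrec fun a => (f a).2 :=
  Primrec.snd.comp hf

@[fun_prop] theorem add {f g : α → ℕ} (hf : Primrec f) (hg : Primrec g) :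
    Primrec fun a => f a + g a := Primrec.nat_add.comp hf hg

@[fun_prop] theorem map {f : α → List β} {g : α → β → γ} (hf : Primrec f)
    (hg : Primrec fun p : α × β => g p.1 p.2) :
    Primrec fun a => (f a).map (fun b => g a b) := Primrec.list_map hf hg

@[fun_prop] theorem unpair {f : α → ℕ} (hf : Primrec f) : Primrec fun a => (f a).unpair :=
  Primrec.unpair.comp hf

@[fun_prop] theorem natPair {f g : α → ℕ} (hf : Primrec f) (hg : Primrec g) :
    Primrec fun a => Nat.pair (f a) (g a) := Primrec₂.natPair.comp hf hg

@[fun_prop] theorem range {f : α → ℕ} (hf : Primrec f) : Primrec fun a => List.range (f a) :=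
  Primrec.list_range.comp hf

@[fun_prop] theorem length {f : α → List β} (hf : Primrec f) : Primrec fun a => (f a).length :=
  Primrec.list_length.comp hf

@[fun_prop] theorem getD {f : α → List β} {g : α → ℕ} {d : β} (hf : Primrec f)
    (hg : Primrec g) : Primrec fun a => (f a).getD (g a) d := (Primrec.list_getD d).comp hf hg

@[fun_prop] theorem take {f : α → List β} {g : α → ℕ} (hf : Primrec f) (hg : Primrec g) :
    Primrec fun a => (f a).take (g a) := Primrec.list_take.comp hg hf

@[fun_prop] theorem append {f g : α → List β} (hf : Primrec f) (hg : Primrec g) :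
    Primrec fun a => f a ++ g a := Primrec.list_append.comp hf hg

@[fun_prop] theorem cons {f : α → β} {g : α → List β} (hf : Primrec f) (hg : Primrec g) :
    Primrec fun a => f a :: g a := Primrec.list_cons.comp hf hg

@[fun_prop] theorem encode {f : α → β} (hf : Primrec f) :
    Primrec fun a => Encodable.encode (f a) := Primrec.encode.comp hf

@[fun_prop] theorem decode {f : α → ℕ} (hf : Primrec f) :
    Primrec fun a => (Encodable.decode (f a) : Option β) := Primrec.decode.comp hf

@[fun_prop] theorem option_getD {f : α → Option β} {g : α → β} (hf : Primrec f)
    (hg : Primrec g) : Primrec fun a => (f a).getD (g a) :=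
  Primrec.option_getD.comp hf hg

@[fun_prop] theorem and {f g : α → Bool} (hf : Primrec f) (hg : Primrec g) :
    Primrec fun a => f a && g a := Primrec.and.comp hf hg

@[fun_prop] theorem not {f : α → Bool} (hf : Primrec f) :
    Primrec fun a => !(f a) := Primrec.not.comp hf

@[fun_prop] theorem cond {f : α → Bool} {g h : α → β} (hf : Primrec f) (hg : Primrec g)
    (hh : Primrec h) : Primrec fun a => bif f a then g a else h a := Primrec.cond hf hg hh

@[fun_prop] theorem decide_lt {f g : α → ℕ} (hf : Primrec f) (hg : Primrec g) :
    Primrec fun a => decide (f a < g a) :=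
  (PrimrecPred.decide (Primrec.nat_lt.comp hf hg)).of_eq fun _ => by congr

@[fun_prop] theorem decide_eq [DecidableEq β] {f g : α → β} (hf : Primrec f)
    (hg : Primrec g) : Primrec fun a => decide (f a = g a) :=
  (PrimrecPred.decide (Primrec.eq.comp hf hg)).of_eq fun _ => by congr

end PrimrecRule

end PrimrecRules

/-- The list of the first `n` values of a sequence. -/
def initSeg {β : Type*} (x : ℕ → β) (n : ℕ) : List β := (List.range n).map x

/-- The pointwise pairing of two elements of the Baire space. -/
def join (x y : NN) : NN := fun i => Nat.pair (x i) (y i)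

@[simp] theorem length_initSeg {β : Type*} (x : ℕ → β) (n : ℕ) : (initSeg x n).length = n := by
  simp [initSeg]

@[simp] theorem initSeg_zero {β : Type*} (x : ℕ → β) : initSeg x 0 = [] := rfl

theorem initSeg_succ {β : Type*} (x : ℕ → β) (n : ℕ) :
    initSeg x (n + 1) = initSeg x n ++ [x n] := by
  simp [initSeg, List.range_succ]

theorem initSeg_getD (x : NN) (n i : ℕ) :
    (initSeg x n).getD i 0 = if i < n then x i else 0 := by
  unfold initSeg
  by_cases h : i < n <;> simp [List.getD, h]

theorem map_initSeg {β γ : Type*} (h : β → γ) (x : ℕ → β) (n : ℕ) :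
    (initSeg x n).map h = initSeg (fun i => h (x i)) n := by
  simp [initSeg, Function.comp_def]

theorem take_initSeg {β : Type*} (x : ℕ → β) {m n : ℕ} (h : m ≤ n) :
    (initSeg x n).take m = initSeg x m := by
  simp [initSeg, ← List.map_take, List.take_range, h]

theorem initSeg_congr {β : Type*} {x y : ℕ → β} {n : ℕ} (h : ∀ i < n, x i = y i) :
    initSeg x n = initSeg y n :=
  List.map_congr_left fun i hi => h i (List.mem_range.1 hi)

section Calculus

variable {α β : Type} [Primcodable α] [Primcodable β]

/-- Lightface `Σ¹₁` relations between elements of a primitively codable type and of the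
Baire space. -/
def Sig (R : α → NN → Prop) : Prop :=
  ∃ f : α × List ℕ → Bool, Computable f ∧
    ∀ k x, R k x ↔ ∃ y, ∀ n, f (k, initSeg (join x y) n) = true

namespace Sig

theorem of_iff {R R' : α → NN → Prop} (h : Sig R) (e : ∀ k x, R' k x ↔ R k x) : Sig R' := by
  obtain ⟨f, hf, H⟩ := h
  exact ⟨f, hf, fun k x => (e k x).trans (H k x)⟩

theorem atom {R : α → NN → Prop} (m : α → ℕ) (q : α × List ℕ → Bool) (hm : Primrec m)
    (hq : Primrec q) (h : ∀ k x, R k x ↔ q (k, initSeg x (m k)) = true) : Sig R := by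
  refine ⟨fun p => bif decide (p.2.length = m p.1) then q (p.1, p.2.map fun v => v.unpair.1)
    else true, Primrec.to_comp (by fun_prop), fun k x => ?_⟩
  rw [h]
  have e : ∀ y n, (initSeg (join x y) n).map (fun v => v.unpair.1) = initSeg x n := by
    intro y n
    simp [map_initSeg, join]
  simp only [e, length_initSeg]
  constructor
  · intro hq
    refine ⟨x, fun n => ?_⟩
    by_cases hn : n = m k
    · simp [hn, hq]
    · simp [hn]
  · rintro ⟨y, hy⟩
    simpa using hy (m k)

theorem comp {R : β → NN → Prop} (hR : Sig R) {g : α → β} (hg : Primrec g) :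
    Sig (fun k x => R (g k) x) := by
  obtain ⟨f, hf, H⟩ := hR
  refine ⟨fun p => f (g p.1, p.2), hf.comp (Primrec.to_comp (by fun_prop)), fun k x => H _ _⟩

theorem comp_real {R : α → NN → Prop} (hR : Sig R) {h : ℕ → ℕ} (hh : Primrec h) :
    Sig (fun k x => R k (fun i => h (x i))) := by
  obtain ⟨f, hf, H⟩ := hR
  refine ⟨fun p => f (p.1, p.2.map fun v => Nat.pair (h v.unpair.1) v.unpair.2),
    hf.comp (Primrec.to_comp (by fun_prop)), fun k x => ?_⟩
  beta_reduce
  rw [H]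
  simp only [map_initSeg, join, Nat.unpair_pair]
  rfl

theorem and {R R' : α → NN → Prop} (hR : Sig R) (hR' : Sig R') :
    Sig (fun k x => R k x ∧ R' k x) := by
  obtain ⟨f, hf, H⟩ := hR
  obtain ⟨f', hf', H'⟩ := hR'
  refine ⟨fun p => f (p.1, p.2.map fun v => Nat.pair v.unpair.1 v.unpair.2.unpair.1) &&
    f' (p.1, p.2.map fun v => Nat.pair v.unpair.1 v.unpair.2.unpair.2),
    Primrec.and.to_comp.comp (hf.comp (Primrec.to_comp (by fun_prop)))
    (hf'.comp (Primrec.to_comp (by fun_prop))), fun k x => ?_⟩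
  beta_reduce
  rw [H, H']
  simp only [map_initSeg, join, Bool.and_eq_true, Nat.unpair_pair]
  constructor
  · rintro ⟨⟨y, hy⟩, ⟨y', hy'⟩⟩
    refine ⟨join y y', fun n => ?_⟩
    simp only [join, Nat.unpair_pair]
    exact ⟨hy n, hy' n⟩
  · rintro ⟨y, hy⟩
    exact ⟨⟨_, fun n => (hy n).1⟩, ⟨_, fun n => (hy n).2⟩⟩

theorem ex_real {R : α → NN → NN → Prop}
    (hR : Sig (fun k z => R k (fun i => (z i).unpair.1) (fun i => (z i).unpair.2))) :
    Sig (fun k x => ∃ y, R k x y) := by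
  obtain ⟨f, hf, H⟩ := hR
  refine ⟨fun p => f (p.1, p.2.map fun v => Nat.pair (Nat.pair v.unpair.1 v.unpair.2.unpair.1)
    v.unpair.2.unpair.2),
    hf.comp (Primrec.to_comp (by fun_prop)), fun k x => ?_⟩
  have e : ∀ y, R k x y ↔ ∃ u, ∀ n, f (k, initSeg (join (join x y) u) n) = true := by
    intro y
    rw [← H]
    simp [join]
  simp only [e, map_initSeg]
  constructor
  · rintro ⟨y, u, hu⟩
    refine ⟨join y u, fun n => ?_⟩
    simp only [join, Nat.unpair_pair]
    exact hu n
  · rintro ⟨v, hv⟩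
    refine ⟨fun i => (v i).unpair.1, fun i => (v i).unpair.2, fun n => ?_⟩
    have := hv n
    simp only [join, Nat.unpair_pair] at this
    exact this

theorem ex_nat {R : α → ℕ → NN → Prop} (hR : Sig (fun (k : α × ℕ) x => R k.1 k.2 x)) :
    Sig (fun k x => ∃ m, R k m x) := by
  obtain ⟨f, hf, H⟩ := hR
  refine ⟨fun p => bif decide (p.2.length = 0) then true else
      f ((p.1, (p.2.getD 0 0).unpair.2.unpair.1), []) &&
      f ((p.1, (p.2.getD 0 0).unpair.2.unpair.1),
        p.2.map fun v => Nat.pair v.unpair.1 v.unpair.2.unpair.2), ?_, fun k x => ?_⟩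
  · refine Computable.cond (Primrec.to_comp (by fun_prop)) (Computable.const _) ?_
    exact Primrec.and.to_comp.comp (hf.comp (Primrec.to_comp (by fun_prop)))
      (hf.comp (Primrec.to_comp (by fun_prop)))
  have e : ∀ m, R k m x ↔ ∃ y, ∀ n, f ((k, m), initSeg (join x y) n) = true := fun m => H (k, m) x
  simp only [e, map_initSeg, length_initSeg, initSeg_getD]
  constructor
  · rintro ⟨m, y, hy⟩
    refine ⟨fun i => Nat.pair m (y i), fun n => ?_⟩
    rcases Nat.eq_zero_or_pos n with rfl | hn
    · simp
    · simp only [hn.ne', hn, join, if_true, Nat.unpair_pair]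
      have h0 := hy 0
      rw [initSeg_zero] at h0
      rw [h0, Bool.true_and]
      simp only [decide_false, cond_false]
      exact hy n
  · rintro ⟨v, hv⟩
    refine ⟨(v 0).unpair.1, fun i => (v i).unpair.2, fun n => ?_⟩
    rcases Nat.eq_zero_or_pos n with rfl | hn
    · have := hv 1
      simp [join] at this
      exact this.1
    · have := hv n
      simp [join, hn, hn.ne'] at this
      exact this.2

theorem all_nat {R : α → ℕ → NN → Prop} (hR : Sig (fun (k : α × ℕ) x => R k.1 k.2 x)) :
    Sig (fun k x => ∀ m, R k m x) := by
  obtain ⟨f, hf, H⟩ := hR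
  refine ⟨fun p => f ((p.1, p.2.length.unpair.1), (List.range p.2.length.unpair.2).map fun i =>
      Nat.pair (p.2.getD i 0).unpair.1
        (p.2.getD (Nat.pair p.2.length.unpair.1 i) 0).unpair.2),
    hf.comp (Primrec.to_comp (by fun_prop)), fun k x => ?_⟩
  have e : ∀ m, R k m x ↔ ∃ y, ∀ n, f ((k, m), initSeg (join x y) n) = true := fun m => H (k, m) x
  have key : ∀ (y : NN) (N : ℕ), ((List.range N.unpair.2).map fun i =>
      Nat.pair ((initSeg (join x y) N).getD i 0).unpair.1
        ((initSeg (join x y) N).getD (Nat.pair N.unpair.1 i) 0).unpair.2) =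
      initSeg (join x fun i => y (Nat.pair N.unpair.1 i)) N.unpair.2 := by
    intro y N
    refine initSeg_congr fun i hi => ?_
    have h1 : i < N := hi.trans_le (Nat.unpair_right_le N)
    have h2 : Nat.pair N.unpair.1 i < N := by
      conv_rhs => rw [← Nat.pair_unpair N]
      exact Nat.pair_lt_pair_right _ hi
    rw [initSeg_getD, initSeg_getD, if_pos h1, if_pos h2]
    simp [join]
  simp only [e, length_initSeg, key]
  constructor
  · intro h
    choose y hy using h
    refine ⟨fun N => y N.unpair.1 N.unpair.2, fun N => ?_⟩
    simpa using hy N.unpair.1 N.unpair.2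
  · rintro ⟨y, hy⟩ m
    refine ⟨fun i => y (Nat.pair m i), fun n => ?_⟩
    simpa using hy (Nat.pair m n)

theorem or {R R' : α → NN → Prop} (hR : Sig R) (hR' : Sig R') :
    Sig (fun k x => R k x ∨ R' k x) := by
  have : Sig (fun (k : α × ℕ) x => if k.2 = 0 then R k.1 x else R' k.1 x) := by
    obtain ⟨f, hf, H⟩ := hR
    obtain ⟨f', hf', H'⟩ := hR'
    refine ⟨fun p => bif decide (p.1.2 = 0) then f (p.1.1, p.2) else f' (p.1.1, p.2),
      Computable.cond (Primrec.to_comp (by fun_prop)) (hf.comp (Primrec.to_comp (by fun_prop)))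
      (hf'.comp (Primrec.to_comp (by fun_prop))), fun k x => ?_⟩
    by_cases h : k.2 = 0
    · simp [h, H]
    · simp [h, H']
  refine (ex_nat (R := fun k m x => if m = 0 then R k x else R' k x) this).of_iff fun k x => ?_
  constructor
  · rintro (h | h)
    · exact ⟨0, by simpa using h⟩
    · exact ⟨1, by simpa using h⟩
  · rintro ⟨m, hm⟩
    split_ifs at hm
    · exact .inl hm
    · exact .inr hm

theorem ex [Inhabited β] {R : α → β → NN → Prop}
    (hR : Sig (fun (k : α × β) x => R k.1 k.2 x)) : Sig (fun k x => ∃ v, R k v x) := by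
  have h := hR.comp (g := fun k : α × ℕ => (k.1, (Encodable.decode k.2).getD default))
    (by fun_prop)
  refine (ex_nat (R := fun k m x => R k ((Encodable.decode m).getD default) x) h).of_iff
    fun k x => ?_
  exact ⟨fun ⟨v, hv⟩ => ⟨Encodable.encode v, by simpa using hv⟩, fun ⟨m, hm⟩ => ⟨_, hm⟩⟩

theorem all [Inhabited β] {R : α → β → NN → Prop}
    (hR : Sig (fun (k : α × β) x => R k.1 k.2 x)) : Sig (fun k x => ∀ v, R k v x) := by
  have h := hR.comp (g := fun k : α × ℕ => (k.1, (Encodable.decode k.2).getD default))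
    (by fun_prop)
  refine (all_nat (R := fun k m x => R k ((Encodable.decode m).getD default) x) h).of_iff
    fun k x => ?_
  exact ⟨fun hv m => hv _, fun hm v => by simpa using hm (Encodable.encode v)⟩

theorem exists_fin {n : ℕ} {R : Fin n → α → NN → Prop} (hR : ∀ i, Sig (R i)) :
    Sig (fun k x => ∃ i, R i k x) := by
  induction n with
  | zero =>
    exact (atom (R := fun (_ : α) _ => False) (fun _ => 0) (fun _ => false) (by fun_prop)
      (by fun_prop) (by simp)).of_iff (by simp)
  | succ n ih =>
    refine ((hR 0).or (ih fun i => hR i.succ)).of_iff fun k x => ?_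
    exact Fin.exists_fin_succ

end Sig

/-- Lightface `Δ¹₁` relations. -/
def Dl (R : α → NN → Prop) : Prop := Sig R ∧ Sig (fun k x => ¬ R k x)

namespace Dl

theorem of_iff {R R' : α → NN → Prop} (h : Dl R) (e : ∀ k x, R' k x ↔ R k x) : Dl R' :=
  ⟨h.1.of_iff e, h.2.of_iff fun k x => not_congr (e k x)⟩

theorem atom {R : α → NN → Prop} (m : α → ℕ) (q : α × List ℕ → Bool) (hm : Primrec m)
    (hq : Primrec q) (h : ∀ k x, R k x ↔ q (k, initSeg x (m k)) = true) : Dl R :=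
  ⟨Sig.atom m q hm hq h, Sig.atom m (fun p => !(q p)) hm (by fun_prop) fun k x => by
    rw [h]; simp⟩

theorem not {R : α → NN → Prop} (h : Dl R) : Dl (fun k x => ¬ R k x) :=
  ⟨h.2, h.1.of_iff fun _ _ => not_not⟩

theorem and {R R' : α → NN → Prop} (hR : Dl R) (hR' : Dl R') :
    Dl (fun k x => R k x ∧ R' k x) :=
  ⟨hR.1.and hR'.1, (hR.2.or hR'.2).of_iff fun _ _ => not_and_or⟩

theorem or {R R' : α → NN → Prop} (hR : Dl R) (hR' : Dl R') :
    Dl (fun k x => R k x ∨ R' k x) :=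
  ⟨hR.1.or hR'.1, (hR.2.and hR'.2).of_iff fun _ _ => not_or⟩

theorem imp {R R' : α → NN → Prop} (hR : Dl R) (hR' : Dl R') :
    Dl (fun k x => R k x → R' k x) :=
  (hR.not.or hR').of_iff fun _ _ => imp_iff_not_or

theorem ex [Inhabited β] {R : α → β → NN → Prop}
    (hR : Dl (fun (k : α × β) x => R k.1 k.2 x)) : Dl (fun k x => ∃ v, R k v x) :=
  ⟨hR.1.ex, (Sig.all hR.2).of_iff fun _ _ => not_exists⟩

theorem all [Inhabited β] {R : α → β → NN → Prop}
    (hR : Dl (fun (k : α × β) x => R k.1 k.2 x)) : Dl (fun k x => ∀ v, R k v x) :=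
  ⟨hR.1.all, (Sig.ex hR.2).of_iff fun _ _ => not_forall⟩

theorem comp {R : β → NN → Prop} (hR : Dl R) {g : α → β} (hg : Primrec g) :
    Dl (fun k x => R (g k) x) := ⟨hR.1.comp hg, hR.2.comp hg⟩

theorem comp_real {R : α → NN → Prop} (hR : Dl R) {h : ℕ → ℕ} (hh : Primrec h) :
    Dl (fun k x => R k (fun i => h (x i))) := ⟨hR.1.comp_real hh, hR.2.comp_real hh⟩

end Dl

theorem Sig.read [Inhabited β] {R : β → NN → Prop} (hR : Sig R) (m : α → ℕ)
    (q : α × List ℕ → β) (hm : Primrec m) (hq : Primrec q) :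
    Sig (fun k x => R (q (k, initSeg x (m k))) x) := by
  classical
  have h1 : Sig (fun (k : α × β) x => q (k.1, initSeg x (m k.1)) = k.2) :=
    Sig.atom (fun k => m k.1) (fun p => decide (q (p.1.1, p.2) = p.1.2)) (by fun_prop)
      (by fun_prop) (by simp)
  have h2 : Sig (fun (k : α × β) x => R k.2 x) := hR.comp (by fun_prop)
  refine (Sig.ex (R := fun k v x => q (k, initSeg x (m k)) = v ∧ R v x) (h1.and h2)).of_iff
    fun k x => by simp

/-- Substitution of a finite piece of the real variable for the numerical parameter. -/
theorem Dl.read [Inhabited β] {R : β → NN → Prop} (hR : Dl R) (m : α → ℕ)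
    (q : α × List ℕ → β) (hm : Primrec m) (hq : Primrec q) :
    Dl (fun k x => R (q (k, initSeg x (m k))) x) :=
  ⟨hR.1.read m q hm hq, hR.2.read m q hm hq⟩

end Calculus

theorem exists_seq_of_step {β : Type*} {P : List β → β → Prop} (h : ∀ t, ∃ c, P t c) :
    ∃ x : ℕ → β, ∀ n, P (initSeg x n) (x n) := by
  choose c hc using h
  let t : ℕ → List β := fun n => Nat.rec [] (fun _ u => u ++ [c u]) n
  have ht : ∀ n, initSeg (fun k => c (t k)) n = t n := by
    intro n
    induction n with
    | zero => rfl
    | succ n ih => rw [initSeg_succ, ih]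
  exact ⟨fun n => c (t n), fun n => by rw [ht]; exact hc _⟩

theorem exists_branch {β : Type*} [Nonempty β] {Q : List β → Prop} (h0 : Q [])
    (hs : ∀ t, Q t → ∃ c, Q (t ++ [c])) : ∃ x : ℕ → β, ∀ n, Q (initSeg x n) := by
  obtain ⟨x, hx⟩ := exists_seq_of_step (P := fun t c => Q t → Q (t ++ [c])) fun t => by
    by_cases ht : Q t
    · obtain ⟨c, hc⟩ := hs t ht
      exact ⟨c, fun _ => hc⟩
    · exact ⟨Classical.arbitrary β, fun h => absurd h ht⟩
  refine ⟨x, fun n => ?_⟩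
  induction n with
  | zero => exact h0
  | succ n ih => rw [initSeg_succ]; exact hx n ih

section Ramsey

open Filter

/-- The increasing sequences which extend `s` and afterwards are branches of the tree whose
successor sets are given by `F`. -/
def treeBox (s : List ℕ) (F : List ℕ → Set ℕ) : Set IncSeq :=
  {x | initSeg x.1 s.length = s ∧ ∀ k, s.length ≤ k → x.1 k ∈ F (initSeg x.1 k)}

/-- Trees all of whose nodes have a large set of successors. -/
def LargeTree (F : List ℕ → Set ℕ) : Prop := ∀ t, F t ∈ hyperfilter ℕ

/-- `X` contains all branches with stem `s` of some large tree. -/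
def Accepts (s : List ℕ) (X : Set IncSeq) : Prop := ∃ F, LargeTree F ∧ treeBox s F ⊆ X

theorem Accepts.mono {s : List ℕ} {X Y : Set IncSeq} (h : Accepts s X) (hXY : X ⊆ Y) :
    Accepts s Y := by
  obtain ⟨F, hF, hX⟩ := h
  exact ⟨F, hF, hX.trans hXY⟩

/-- Every stem decides `X` by a large tree. -/
def Decided (X : Set IncSeq) : Prop := ∀ s, Accepts s X ∨ Accepts s Xᶜ

/-- If a large set of one-step extensions of `s` accepts `X`, then so does `s`. -/
theorem Accepts.of_successors {s : List ℕ} {X : Set IncSeq}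
    (h : {n | Accepts (s ++ [n]) X} ∈ hyperfilter ℕ) : Accepts s X := by
  classical
  choose! G hG hGX using fun n (hn : Accepts (s ++ [n]) X) => hn
  let F : List ℕ → Set ℕ := fun t =>
    if h : s.length < t.length then
      if Accepts (s ++ [t[s.length]]) X then G t[s.length] t else univ
    else {n | Accepts (s ++ [n]) X}
  refine ⟨F, fun t => ?_, fun x hx => ?_⟩
  · simp only [F]
    split_ifs with h1 h2
    · exact hG _ h2 t
    · exact univ_mem
    · exact h
  · have h0 := hx.2 s.length le_rfl
    simp only [F, length_initSeg, lt_irrefl, dite_false] at h0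
    refine hGX (x.1 s.length) h0 ⟨?_, fun k hk => ?_⟩
    · rw [List.length_append, List.length_singleton, initSeg_succ, hx.1]
    · rw [List.length_append, List.length_singleton] at hk
      have h1 := hx.2 k (by omega)
      have h2 : s.length < k := by omega
      have e : ∀ hh, (initSeg x.1 k)[s.length]'hh = x.1 s.length := fun hh => by
        simp [initSeg]
      have h3 : Accepts (s ++ [x.1 s.length]) X := h0
      simpa only [F, length_initSeg, h2, dite_true, e, if_pos h3] using h1

theorem Decided.compl {X : Set IncSeq} (h : Decided X) : Decided Xᶜ := fun s => by
  rw [compl_compl]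
  exact (h s).symm

theorem Decided.iUnion {X : ℕ → Set IncSeq} (h : ∀ m, Decided (X m)) :
    Decided (⋃ m, X m) := by
  classical
  intro s
  by_cases hs : Accepts s (⋃ m, X m)
  · exact .inl hs
  right
  have hrej : ∀ t, ¬ Accepts t (⋃ m, X m) →
      {n | ¬ Accepts (t ++ [n]) (⋃ m, X m)} ∈ hyperfilter ℕ := by
    intro t ht
    have : {n | Accepts (t ++ [n]) (⋃ m, X m)} ∉ hyperfilter ℕ := fun h =>
      ht (Accepts.of_successors h)
    exact Ultrafilter.compl_mem_iff_notMem.2 this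
  have hacc : ∀ t m, ¬ Accepts t (⋃ m, X m) → Accepts t (X m)ᶜ := fun t m ht =>
    (h m t).resolve_left fun h => ht (h.mono (subset_iUnion X m))
  choose! G hG hGX using hacc
  let F : List ℕ → Set ℕ := fun t =>
    {n | ¬ Accepts t (⋃ m, X m) → ¬ Accepts (t ++ [n]) (⋃ m, X m)} ∩
      ⋂ p ∈ Finset.range (t.length + 1) ×ˢ Finset.range (t.length + 1),
        {n | ¬ Accepts (t.take p.1) (⋃ m, X m) → n ∈ G (t.take p.1) p.2 t}
  refine ⟨F, fun t => inter_mem ?_ ?_, fun x hx => ?_⟩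
  · by_cases ht : Accepts t (⋃ m, X m)
    · simp [ht]
    · simpa [ht] using hrej t ht
  · rw [biInter_finset_mem]
    intro p _
    by_cases ht : Accepts (t.take p.1) (⋃ m, X m)
    · simp [ht]
    · exact mem_of_superset (hG _ p.2 ht t) fun n hn _ => hn
  · have hr : ∀ k, s.length ≤ k → ¬ Accepts (initSeg x.1 k) (⋃ m, X m) := by
      intro k hk
      induction k, hk using Nat.le_induction with
      | base => rwa [hx.1]
      | succ k hk ih =>
        rw [initSeg_succ]
        exact (hx.2 k hk).1 ih
    simp only [mem_compl_iff, mem_iUnion, not_exists]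
    intro m
    set k := max m s.length with hkdef
    have hsk : s.length ≤ k := le_max_right _ _
    refine hGX (initSeg x.1 k) m (hr k hsk) ⟨by simp, fun j hj => ?_⟩
    rw [length_initSeg] at hj
    have h2 := (hx.2 j (hsk.trans hj)).2
    simp only [mem_iInter] at h2
    have h3 := h2 (k, m) (by
      simp only [Finset.mem_product, Finset.mem_range, length_initSeg]
      omega)
    simp only [take_initSeg x.1 hj] at h3
    exact h3 (hr k hsk)

theorem decided_coordinate (k a : ℕ) : Decided {x : IncSeq | x.1 k = a} := by
  classical
  intro s
  by_cases hk : k < s.length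
  · by_cases ha : s.getD k 0 = a
    · refine .inl ⟨fun _ => univ, fun _ => univ_mem, fun x hx => ?_⟩
      rw [← hx.1, initSeg_getD, if_pos hk] at ha
      exact ha
    · refine .inr ⟨fun _ => univ, fun _ => univ_mem, fun x hx => ?_⟩
      rw [← hx.1, initSeg_getD, if_pos hk] at ha
      exact ha
  · exact .inr ⟨fun _ => {a}ᶜ, fun _ => compl_mem_hyperfilter_of_finite (finite_singleton a),
      fun x hx => hx.2 k (not_lt.1 hk)⟩

theorem decided_of_measurableSet {X : Set IncSeq} (hX : MeasurableSet X) : Decided X := by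
  let D : MeasurableSpace IncSeq :=
    { MeasurableSet' := Decided
      measurableSet_empty := fun s => .inr ⟨fun _ => univ, fun _ => univ_mem, by simp⟩
      measurableSet_compl := fun _ h => h.compl
      measurableSet_iUnion := fun _ h => Decided.iUnion h }
  have hle : (Subtype.instMeasurableSpace : MeasurableSpace IncSeq) ≤ D := by
    have : @Measurable IncSeq NN D _ Subtype.val := by
      refine @measurable_pi_lambda _ _ _ D _ _ fun k => ?_
      exact @measurable_to_countable' _ _ _ _ D _ fun a => decided_coordinate k a
    exact this.comap_le
  exact hle X hX

/-- The shift graph on the space of all infinite sets has no finite Borel coloring. -/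
theorem not_exists_measurable_coloring {n : ℕ} (c : IncSeq → Fin n) (hc : Measurable c) :
    ∃ x, c x = c (shift x) := by
  classical
  have hdec : ∀ i, Decided (c ⁻¹' {i}) := fun i =>
    decided_of_measurableSet (hc (measurableSet_singleton i))
  have hacc : ∀ i, ∃ F, LargeTree F ∧
      (treeBox [] F ⊆ c ⁻¹' {i} ∨ treeBox [] F ⊆ (c ⁻¹' {i})ᶜ) := by
    intro i
    rcases hdec i [] with ⟨F, hF, h⟩ | ⟨F, hF, h⟩
    · exact ⟨F, hF, .inl h⟩
    · exact ⟨F, hF, .inr h⟩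
  choose F hF hFc using hacc
  have hstep : ∀ t : List ℕ, ∃ m, (∀ v ∈ t, v < m) ∧ ∀ i, m ∈ F i t ∧ m ∈ F i t.tail := by
    intro t
    have h1 : {m | ∀ v ∈ t, v < m} ∈ hyperfilter ℕ := by
      apply Filter.mem_hyperfilter_of_finite_compl
      refine (finite_Iic t.sum).subset fun m hm => ?_
      simp only [mem_compl_iff, mem_ofPred_eq, not_forall, not_lt] at hm
      obtain ⟨v, hv, hmv⟩ := hm
      exact hmv.trans (List.single_le_sum (by simp) v hv)
    have h2 : (⋂ i, (F i t ∩ F i t.tail)) ∈ hyperfilter ℕ :=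
      Filter.iInter_mem.2 fun i => inter_mem (hF i t) (hF i t.tail)
    obtain ⟨m, hm1, hm2⟩ := Ultrafilter.nonempty_of_mem (inter_mem h1 h2)
    exact ⟨m, hm1, fun i => mem_iInter.1 hm2 i⟩
  obtain ⟨x, hx⟩ := exists_seq_of_step hstep
  have hmono : StrictMono x := strictMono_nat_of_lt_succ fun k =>
    (hx (k + 1)).1 _ (by simp [initSeg_succ])
  let X : IncSeq := ⟨x, hmono⟩
  have htail : ∀ k, (initSeg x (k + 1)).tail = initSeg (shift X).1 k := by
    intro k
    simp [initSeg, List.range_succ_eq_map, shift, X, Function.comp_def]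
  have hX : ∀ i, X ∈ treeBox [] (F i) := fun i => ⟨rfl, fun k _ => ((hx k).2 i).1⟩
  have hSX : ∀ i, shift X ∈ treeBox [] (F i) := fun i => ⟨rfl, fun k _ => by
    rw [← htail]
    exact ((hx (k + 1)).2 i).2⟩
  refine ⟨X, ?_⟩
  have h := (hFc (c X)).resolve_right fun h => h (hX _) rfl
  exact (h (hSX _)).symm

end Ramsey

section Codes

open Nat.Partrec (Code)

/-- The lists accepted by the `e`-th program; every computable predicate on lists has this
form, and `Passes` itself is arithmetical. -/
def Passes (e : ℕ) (w : List ℕ) : Prop :=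
  0 ∉ (Denumerable.ofNat Code e).eval (Encodable.encode w)

theorem dl_passes : Dl (fun (k : ℕ × List ℕ) _ => Passes k.1 k.2) := by
  have h : Dl (fun (k : (ℕ × List ℕ) × ℕ) _ =>
      ¬ (Denumerable.ofNat Code k.1.1).evaln k.2 (Encodable.encode k.1.2) = some 0) := by
    refine Dl.not (Dl.atom (fun _ => 0) (fun p => decide
      ((Denumerable.ofNat Code p.1.1.1).evaln p.1.2 (Encodable.encode p.1.1.2) = some 0))
      (by fun_prop) ?_ (by simp))
    have h1 : Primrec fun p : ((ℕ × List ℕ) × ℕ) × List ℕ =>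
        (Denumerable.ofNat Code p.1.1.1).evaln p.1.2 (Encodable.encode p.1.1.2) :=
      Code.primrec_evaln.comp (((Primrec.snd.comp Primrec.fst).pair
        ((Primrec.ofNat Code).comp (by fun_prop))).pair (by fun_prop))
    fun_prop
  refine (Dl.all (R := fun (k : ℕ × List ℕ) s _ =>
    ¬ (Denumerable.ofNat Code k.1).evaln s (Encodable.encode k.2) = some 0) h).of_iff
    fun k x => ?_
  rw [Passes, Code.evaln_complete, not_exists]
  rfl

theorem exists_passes_iff_self {F : ℕ × List ℕ → Bool} (hF : Computable F) :
    ∃ e, ∀ w, Passes e w ↔ F (e, w) = true := by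
  have h : Partrec₂ fun (c : Code) (n : ℕ) => Part.some
      (bif F (Encodable.encode c, (Encodable.decode n).getD []) then 1 else 0) := by
    have : Computable fun p : Code × ℕ =>
        bif F (Encodable.encode p.1, (Encodable.decode p.2).getD []) then 1 else 0 :=
      Computable.cond (hF.comp (Primrec.to_comp (by fun_prop))) (Computable.const _)
        (Computable.const _)
    exact this.partrec
  obtain ⟨c, hc⟩ := Code.fixed_point₂ h
  refine ⟨Encodable.encode c, fun w => ?_⟩
  rw [Passes, Denumerable.ofNat_encode, hc]
  cases h : F (Encodable.encode c, w) <;> simp [h]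

theorem exists_passes_iff {f : List ℕ → Bool} (hf : Computable f) :
    ∃ e, ∀ w, Passes e w ↔ f w = true :=
  exists_passes_iff_self (F := fun p => f p.2) (hf.comp Computable.snd)

/-- The section at `x` of the tree of pairs accepted by the `b`-th program. -/
def Sect (b : ℕ) (x : NN) (t : List ℕ) : Prop :=
  Passes b ((List.range t.length).map fun i => Nat.pair (x i) (t.getD i 0))

theorem sect_initSeg (b : ℕ) (x y : NN) (n : ℕ) :
    Sect b x (initSeg y n) ↔ Passes b (initSeg (join x y) n) := by
  unfold Sect
  rw [length_initSeg]
  refine iff_of_eq (congrArg _ (initSeg_congr fun i hi => ?_))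
  rw [initSeg_getD, if_pos hi, join]

theorem dl_sect : Dl (fun (k : ℕ × List ℕ) x => Sect k.1 x k.2) := by
  refine (dl_passes.read (fun k : ℕ × List ℕ => k.2.length) (fun p => (p.1.1,
    (List.range p.1.2.length).map fun i => Nat.pair (p.2.getD i 0) (p.1.2.getD i 0)))
    (by fun_prop) (by fun_prop)).of_iff fun k x => ?_
  unfold Sect
  refine iff_of_eq (congrArg _ (List.map_congr_left fun i hi => ?_))
  rw [initSeg_getD, if_pos (List.mem_range.1 hi)]

/-- Lists all of whose nonempty initial segments lie in a given tree have an infinite branch. -/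
def HasBranch (T : List ℕ → Prop) : Prop := ∃ y : NN, ∀ n, T (initSeg y (n + 1))

theorem sig_hasBranch : Sig (fun (b : ℕ) x => HasBranch (Sect b x)) := by
  refine Sig.ex_real (R := fun b x y => ∀ n, Sect b x (initSeg y (n + 1)))
    (Sig.all_nat (R := fun b n z => Sect b (fun i => (z i).unpair.1)
      (initSeg (fun i => (z i).unpair.2) (n + 1))) ?_)
  have h := (dl_sect.1.comp_real (h := fun v => v.unpair.1) (by fun_prop)).read
    (fun k : ℕ × ℕ => k.2 + 1) (fun p => (p.1.1, p.2.map fun v => v.unpair.2))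
    (by fun_prop) (by fun_prop)
  simpa only [map_initSeg] using h

theorem exists_hasBranch_iff {R : Unit → NN → Prop} (h : Sig R) :
    ∃ b, ∀ x, R () x ↔ HasBranch (Sect b x) := by
  obtain ⟨f, hf, H⟩ := h
  obtain ⟨b, hb⟩ := exists_passes_iff (f := fun w => f ((), w) && f ((), []))
    (Primrec.and.to_comp.comp (hf.comp (Primrec.to_comp (by fun_prop)))
      (hf.comp (Primrec.to_comp (by fun_prop))))
  refine ⟨b, fun x => ?_⟩
  simp only [H, HasBranch, sect_initSeg, hb, Bool.and_eq_true]
  refine exists_congr fun y => ⟨fun h n => ⟨h _, h 0⟩, fun h n => ?_⟩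
  cases n with
  | zero => exact (h 0).2
  | succ n => exact (h n).1

end Codes

section Simulation

variable {S T : List ℕ → Prop}

/-- The step condition of a simulation `Z` of the tree `S` by the tree `T`. -/
def Simulates (S T : List ℕ → Prop) (s₀ t₀ : List ℕ) : Prop :=
  ∃ z : NN, z (Encodable.encode (s₀, t₀)) = 0 ∧ ∀ s t a, z (Encodable.encode (s, t)) = 0 →
    S (s ++ [a]) → ∃ c, T (t ++ [c]) ∧ z (Encodable.encode (s ++ [a], t ++ [c])) = 0

theorem simulates_iff {s t : List ℕ} : Simulates S T s t ↔
    ∀ a, S (s ++ [a]) → ∃ c, T (t ++ [c]) ∧ Simulates S T (s ++ [a]) (t ++ [c]) := by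
  classical
  have step : ∀ {s t}, Simulates S T s t →
      ∀ a, S (s ++ [a]) → ∃ c, T (t ++ [c]) ∧ Simulates S T (s ++ [a]) (t ++ [c]) := by
    rintro s t ⟨z, h0, hz⟩ a ha
    obtain ⟨c, hc, h⟩ := hz s t a h0 ha
    exact ⟨c, hc, z, h, hz⟩
  refine ⟨step, fun h => ?_⟩
  refine ⟨fun v => if ∃ p : List ℕ × List ℕ, v = Encodable.encode p ∧
    (p = (s, t) ∨ Simulates S T p.1 p.2) then 0 else 1, by simp, ?_⟩
  intro s' t' a h' ha
  have e : ∀ p : List ℕ × List ℕ, (if ∃ q : List ℕ × List ℕ,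
      Encodable.encode p = Encodable.encode q ∧ (q = (s, t) ∨ Simulates S T q.1 q.2)
      then 0 else 1) = 0 ↔ (p = (s, t) ∨ Simulates S T p.1 p.2) := by
    intro p
    have h : (∃ q : List ℕ × List ℕ, Encodable.encode p = Encodable.encode q ∧
        (q = (s, t) ∨ Simulates S T q.1 q.2)) ↔ (p = (s, t) ∨ Simulates S T p.1 p.2) := by
      simp only [Encodable.encode_inj, exists_eq_left']
    rw [← h]
    refine ⟨fun hh => ?_, fun h' => if_pos h'⟩
    by_contra h'
    rw [if_neg h'] at hh
    exact one_ne_zero hh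
  simp only [e] at h' ⊢
  have : ∃ c, T (t' ++ [c]) ∧ Simulates S T (s' ++ [a]) (t' ++ [c]) := by
    rcases h' with h' | h'
    · obtain ⟨rfl, rfl⟩ := Prod.mk.inj h'
      exact h a ha
    · exact step h' a ha
  obtain ⟨c, hc, h⟩ := this
  exact ⟨c, hc, .inr h⟩

theorem exists_of_not_simulates {s t : List ℕ} (h : ¬ Simulates S T s t) :
    ∃ a, S (s ++ [a]) ∧ ∀ c, T (t ++ [c]) → ¬ Simulates S T (s ++ [a]) (t ++ [c]) := by
  rw [simulates_iff] at h
  push Not at h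
  exact h

theorem Simulates.exists_branch {u : List ℕ} (h : Simulates S T [] u) {y : NN}
    (hy : ∀ n, S (initSeg y (n + 1))) : ∃ c : NN, ∀ n, T (u ++ initSeg c (n + 1)) := by
  obtain ⟨c, hc⟩ := _root_.exists_branch (Q := fun t : List ℕ => (t ≠ [] → T (u ++ t)) ∧
      Simulates S T (initSeg y t.length) (u ++ t)) (by simpa using h) (by
    rintro t ⟨-, ht⟩
    obtain ⟨c, hc, h⟩ := simulates_iff.1 ht (y t.length) (by rw [← initSeg_succ]; exact hy _)
    refine ⟨c, ?_, ?_⟩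
    · simpa using hc
    · simpa [initSeg_succ] using h)
  exact ⟨c, fun n => (hc (n + 1)).1 (by simp [initSeg_succ])⟩

theorem HasBranch.of_simulates (hS : HasBranch S) (h : Simulates S T [] []) :
    HasBranch T := by
  obtain ⟨y, hy⟩ := hS
  exact h.exists_branch hy

theorem HasBranch.of_simulates_singleton (hS : HasBranch S) {a : ℕ} (ha : T [a])
    (h : Simulates S T [] [a]) : HasBranch T := by
  obtain ⟨y, hy⟩ := hS
  obtain ⟨c, hc⟩ := h.exists_branch hy
  refine ⟨fun n => Nat.casesOn n a c, fun n => ?_⟩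
  cases n with
  | zero => simpa [initSeg] using ha
  | succ n =>
    convert hc n using 1
    simp [initSeg, List.range_succ_eq_map (n := n + 1), Function.comp_def]

/-- Comparison of ranks: of two trees, one of which has no branch, either the first simulates
into the second or the second simulates strictly into the first. -/
theorem simulates_or_of_not_hasBranch (hT : ¬ HasBranch T) :
    Simulates S T [] [] ∨ ∃ a, S [a] ∧ Simulates T S [] [a] := by
  by_contra! hcon
  obtain ⟨h0, h1⟩ := hcon
  obtain ⟨y, hy⟩ := exists_branch (Q := fun t : List ℕ => (t ≠ [] → T t) ∧
      ∃ s, ¬ Simulates S T s t ∧ ∀ a, S (s ++ [a]) → ¬ Simulates T S t (s ++ [a]))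
    ⟨by simp, [], h0, h1⟩ (by
    rintro t ⟨-, s, hs, hst⟩
    obtain ⟨a, ha, h2⟩ := exists_of_not_simulates hs
    obtain ⟨c, hc, h3⟩ := exists_of_not_simulates (hst a ha)
    exact ⟨c, fun _ => hc, s ++ [a], h2 c hc, h3⟩)
  exact hT ⟨y, fun n => (hy (n + 1)).1 (by simp [initSeg_succ])⟩

theorem sig_simulates : Sig (fun (k : (ℕ × ℕ) × List ℕ) x =>
    Simulates (Sect k.1.1 x) (Sect k.1.2 x) [] k.2) := by
  have hz : Dl (fun (k : List ℕ × List ℕ) x => (x (Encodable.encode k)).unpair.2 = 0) :=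
    Dl.atom (fun k => Encodable.encode k + 1)
      (fun p => decide ((p.2.getD (Encodable.encode p.1) 0).unpair.2 = 0)) (by fun_prop)
      (by fun_prop) (by
        intro k x
        rw [decide_eq_true_iff, initSeg_getD, if_pos (Nat.lt_succ_self _)])
  have hs := dl_sect.comp_real (h := fun v => v.unpair.1) (by fun_prop)
  refine Sig.ex_real (R := fun (k : (ℕ × ℕ) × List ℕ) x z =>
    z (Encodable.encode (([] : List ℕ), k.2)) = 0 ∧
    ∀ s t a, z (Encodable.encode (s, t)) = 0 → Sect k.1.1 x (s ++ [a]) → ∃ c,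
      Sect k.1.2 x (t ++ [c]) ∧ z (Encodable.encode (s ++ [a], t ++ [c])) = 0) (Dl.and ?_ ?_).1
  · exact hz.comp (g := fun k : (ℕ × ℕ) × List ℕ => (([] : List ℕ), k.2))
      (by fun_prop)
  · refine Dl.all (Dl.all (Dl.all (Dl.imp ?_ (Dl.imp ?_ (Dl.ex (Dl.and ?_ ?_))))))
    · exact hz.comp (g := fun k : ((((ℕ × ℕ) × List ℕ) × List ℕ) × List ℕ) × ℕ =>
        (k.1.1.2, k.1.2)) (by fun_prop)
    · exact hs.comp (g := fun k : ((((ℕ × ℕ) × List ℕ) × List ℕ) × List ℕ) × ℕ =>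
        (k.1.1.1.1.1, k.1.1.2 ++ [k.2])) (by fun_prop)
    · exact hs.comp (g := fun k : (((((ℕ × ℕ) × List ℕ) × List ℕ) × List ℕ) × ℕ) × ℕ =>
        (k.1.1.1.1.1.2, k.1.1.2 ++ [k.2])) (by fun_prop)
    · exact hz.comp (g := fun k : (((((ℕ × ℕ) × List ℕ) × List ℕ) × List ℕ) × ℕ) × ℕ =>
        (k.1.1.1.2 ++ [k.1.2], k.1.1.2 ++ [k.2])) (by fun_prop)

end Simulation

section Classes

theorem Sig.comp_succ {α : Type} [Primcodable α] {R : α → NN → Prop} (hR : Sig R) :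
    Sig (fun k x => R k (fun n => x (n + 1))) := by
  have h1 : Sig (fun (_ : α) z => ∀ n, (z n).unpair.2 = (z (n + 1)).unpair.1) :=
    (Dl.all (Dl.atom (fun k : α × ℕ => k.2 + 2) (fun p =>
      decide ((p.2.getD p.1.2 0).unpair.2 = (p.2.getD (p.1.2 + 1) 0).unpair.1)) (by fun_prop)
      (by fun_prop) (by
        intro k x
        simp only [decide_eq_true_iff, initSeg_getD, show k.2 < k.2 + 2 by omega,
          show k.2 + 1 < k.2 + 2 by omega, if_true]))).1
  refine (Sig.ex_real (R := fun k x y => (∀ n, y n = x (n + 1)) ∧ R k y)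
    (h1.and (hR.comp_real (h := fun v => v.unpair.2) (by fun_prop)))).of_iff fun k x => ?_
  constructor
  · exact fun h => ⟨_, fun _ => rfl, h⟩
  · rintro ⟨y, hy, h⟩
    rwa [← funext hy]

theorem dl_strictMono {α : Type} [Primcodable α] : Dl (fun (_ : α) x => StrictMono x) :=
  (Dl.all (R := fun (_ : α) n x => x n < x (n + 1)) (Dl.atom (fun k : α × ℕ => k.2 + 2)
    (fun p => decide (p.2.getD p.1.2 0 < p.2.getD (p.1.2 + 1) 0)) (by fun_prop)
    (by fun_prop) (by
      intro k x
      simp only [decide_eq_true_iff, initSeg_getD, show k.2 < k.2 + 2 by omega,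
          show k.2 + 1 < k.2 + 2 by omega, if_true]))).of_iff
    fun _ _ => ⟨fun h n => h (Nat.lt_succ_self n), strictMono_nat_of_lt_succ⟩

theorem sigmaLight_iff {A : Set NN} : SigmaLight A ↔ Sig (fun (_ : Unit) x => x ∈ A) := by
  constructor
  · rintro ⟨f, hf, rfl⟩
    exact ⟨fun p => f p.2, hf.comp Computable.snd, fun _ _ => Iff.rfl⟩
  · rintro ⟨f, hf, H⟩
    refine ⟨fun w => f ((), w), hf.comp ((Computable.const ()).pair Computable.id), ?_⟩
    ext x
    exact H () x

theorem lightDelta11_of_dl {P : NN → Prop} (h : Dl (fun (_ : Unit) x => P x)) :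
    LightDelta11 {x | P x.1} := by
  refine ⟨sigmaLight_iff.2 ((dl_strictMono.1.and h.1).of_iff fun _ x => ?_),
    sigmaLight_iff.2 ((dl_strictMono.1.and h.2).of_iff fun _ x => ?_)⟩
  · constructor
    · rintro ⟨x, hx, rfl⟩
      exact ⟨x.2, hx⟩
    · rintro ⟨hx, h⟩
      exact ⟨⟨x, hx⟩, h, rfl⟩
  · constructor
    · rintro ⟨x, hx, rfl⟩
      exact ⟨x.2, hx⟩
    · rintro ⟨hx, h⟩
      exact ⟨⟨x, hx⟩, h, rfl⟩

theorem sigmaLight2_of_sig {A : Set (NN × NN)}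
    (h : Sig (fun (_ : Unit) z =>
      ((fun i => (z i).unpair.1, fun i => (z i).unpair.2) : NN × NN) ∈ A)) :
    SigmaLight2 A := by
  obtain ⟨f, hf, H⟩ := h
  refine ⟨fun w => f ((), w.map fun v =>
    Nat.pair (Nat.pair v.unpair.1 v.unpair.2.unpair.1) v.unpair.2.unpair.2),
    hf.comp (Primrec.to_comp (by fun_prop)), ?_⟩
  ext ⟨x, y⟩
  have := H () (join x y)
  simp only [join, Nat.unpair_pair] at this
  simp only [List.map_map, Function.comp_def, Nat.unpair_pair]
  exact this

theorem lightDelta11P_of_dl {P : NN → NN → Prop}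
    (h : Dl (fun (_ : Unit) z => P (fun i => (z i).unpair.1) (fun i => (z i).unpair.2))) :
    LightDelta11P {p | P p.1.1 p.2.1} := by
  have h1 := (dl_strictMono (α := Unit)).1.comp_real (h := fun v => v.unpair.1) (by fun_prop)
  have h2 := (dl_strictMono (α := Unit)).1.comp_real (h := fun v => v.unpair.2) (by fun_prop)
  refine ⟨sigmaLight2_of_sig (((h1.and h2).and h.1).of_iff fun _ z => ?_),
    sigmaLight2_of_sig (((h1.and h2).and h.2).of_iff fun _ z => ?_)⟩
  · constructor
    · rintro ⟨p, hp, he⟩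
      obtain ⟨e1, e2⟩ := Prod.mk.inj he
      rw [← e1, ← e2]
      exact ⟨⟨p.1.2, p.2.2⟩, hp⟩
    · rintro ⟨⟨hx, hy⟩, h⟩
      exact ⟨(⟨_, hx⟩, ⟨_, hy⟩), h, rfl⟩
  · constructor
    · rintro ⟨p, hp, he⟩
      obtain ⟨e1, e2⟩ := Prod.mk.inj he
      beta_reduce
      rw [← e1, ← e2]
      exact ⟨⟨p.1.2, p.2.2⟩, hp⟩
    · rintro ⟨⟨hx, hy⟩, h⟩
      exact ⟨(⟨_, hx⟩, ⟨_, hy⟩), h, rfl⟩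

end Classes

section Sets

/-- The nodes of the tree of increasing lists all of whose initial segments are accepted by
the `e`-th program. -/
def Node (e : ℕ) (w : List ℕ) : Prop :=
  (∀ i, i + 1 < w.length → w.getD i 0 < w.getD (i + 1) 0) ∧ ∀ l, Passes e (w.take l)

/-- The infinite branches of the `e`-th tree. -/
def Branch (e : ℕ) (g : NN) : Prop := StrictMono g ∧ ∀ n, Passes e (initSeg g n)

theorem Branch.node {e : ℕ} {g : NN} (h : Branch e g) (n : ℕ) : Node e (initSeg g n) := by
  refine ⟨fun i hi => ?_, fun l => ?_⟩
  · rw [length_initSeg] at hi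
    rw [initSeg_getD, initSeg_getD, if_pos hi, if_pos (by omega)]
    exact h.1 (Nat.lt_succ_self i)
  · rcases le_total l n with hl | hl
    · rw [take_initSeg _ hl]
      exact h.2 l
    · rw [List.take_of_length_le (by simpa using hl)]
      exact h.2 n

theorem branch_of_node {e : ℕ} {g : NN} (h : ∀ n, Node e (initSeg g n)) : Branch e g := by
  refine ⟨strictMono_nat_of_lt_succ fun n => ?_, fun n => ?_⟩
  · have := (h (n + 2)).1 n (by simp)
    rwa [initSeg_getD, initSeg_getD, if_pos (by omega), if_pos (by omega)] at this
  · have := (h n).2 n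
    rwa [take_initSeg _ le_rfl] at this

theorem Node.take {e : ℕ} {w : List ℕ} (h : Node e w) (l : ℕ) : Node e (w.take l) := by
  refine ⟨fun i hi => ?_, fun k => ?_⟩
  · rw [List.length_take] at hi
    have := h.1 i (by omega)
    simp only [List.getD_eq_getElem?_getD, List.getElem?_take] at this ⊢
    rwa [if_pos (by omega), if_pos (by omega)]
  · rw [List.take_take]
    exact h.2 _

theorem dl_node : Dl (fun (k : ℕ × List ℕ) _ => Node k.1 k.2) := by
  refine Dl.and ?_ (Dl.all ?_)
  · refine Dl.all (Dl.atom (fun _ => 0) (fun p : ((ℕ × List ℕ) × ℕ) × List ℕ =>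
      !(decide (p.1.2 + 1 < p.1.1.2.length)) ||
        decide (p.1.1.2.getD p.1.2 0 < p.1.1.2.getD (p.1.2 + 1) 0)) (by fun_prop) ?_ ?_)
    · exact Primrec.or.comp (by fun_prop) (by fun_prop)
    · intro k x
      rw [Bool.or_eq_true, Bool.not_eq_true', decide_eq_false_iff_not, decide_eq_true_iff,
        imp_iff_not_or]
  · exact dl_passes.comp (g := fun k : (ℕ × List ℕ) × ℕ => (k.1.1, k.1.2.take k.2))
      (by fun_prop)

/-- No translate of `x` bounds the branches of the `e`-th tree, in the strong sense that the
corresponding bounded part of the tree is finite. -/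
def Escapes (e : ℕ) (x : NN) : Prop :=
  ∀ m, ∃ N, ∀ w : List ℕ, N ≤ w.length →
    (∃ i, i < w.length ∧ x (i + m) < w.getD i 0) ∨ ¬ Node e w

theorem dl_escapes : Dl (fun (e : ℕ) x => Escapes e x) := by
  have h1 : Dl (fun (k : ℕ × List ℕ) _ => k.1 ≤ k.2.length) :=
    Dl.atom (fun _ => 0) (fun p => decide (p.1.1 < p.1.2.length + 1)) (by fun_prop)
      (by fun_prop) (fun k x => Nat.lt_succ_iff.symm.trans decide_eq_true_iff.symm)
  have h2 : Dl (fun (k : List ℕ × ℕ) _ => k.2 < k.1.length) :=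
    Dl.atom (fun _ => 0) (fun p => decide (p.1.2 < p.1.1.length)) (by fun_prop)
      (by fun_prop) (fun k x => decide_eq_true_iff.symm)
  have h3 : Dl (fun (k : (ℕ × List ℕ) × ℕ) x => x (k.2 + k.1.1) < k.1.2.getD k.2 0) :=
    Dl.atom (fun k => k.2 + k.1.1 + 1)
      (fun p => decide (p.2.getD (p.1.2 + p.1.1.1) 0 < p.1.1.2.getD p.1.2 0)) (by fun_prop)
      (by fun_prop) (by
        intro k x
        rw [decide_eq_true_iff, initSeg_getD, if_pos (Nat.lt_succ_self _)])
  have h4 : Dl (fun (k : ((ℕ × ℕ) × ℕ) × List ℕ) _ => Node k.1.1.1 k.2) :=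
    dl_node.comp (g := fun k : ((ℕ × ℕ) × ℕ) × List ℕ => (k.1.1.1, k.2)) (by fun_prop)
  have h5 := h1.comp (g := fun k : ((ℕ × ℕ) × ℕ) × List ℕ => (k.1.2, k.2)) (by fun_prop)
  have h6 := h2.comp (g := fun k : (((ℕ × ℕ) × ℕ) × List ℕ) × ℕ => (k.1.2, k.2)) (by fun_prop)
  have h7 := h3.comp (g := fun k : (((ℕ × ℕ) × ℕ) × List ℕ) × ℕ =>
    ((k.1.1.1.2, k.1.2), k.2)) (by fun_prop)
  exact Dl.all (Dl.ex (Dl.all (h5.imp ((Dl.ex (h6.and h7)).or h4.not))))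

theorem Escapes.shift {e : ℕ} {x : NN} (h : Escapes e x) : Escapes e (fun n => x (n + 1)) :=
  fun m => h (m + 1)

theorem Escapes.exists_lt {e : ℕ} {x g : NN} (h : Escapes e x) (hg : Branch e g) (m : ℕ) :
    ∃ n, x (n + m) < g n := by
  obtain ⟨N, hN⟩ := h m
  obtain ⟨i, hi, h⟩ := (hN (initSeg g N) (by simp)).resolve_right (not_not.2 (hg.node N))
  rw [length_initSeg] at hi
  rw [initSeg_getD, if_pos hi] at h
  exact ⟨i, h⟩

theorem escapes_of_forall_not_branch {e : ℕ} (he : ∀ g, ¬ Branch e g) (x : NN) :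
    Escapes e x := by
  intro m
  by_contra! hcon
  obtain ⟨g, hg⟩ := exists_branch (Q := fun t : List ℕ => ∀ N, ∃ w : List ℕ,
      w.take t.length = t ∧ N ≤ w.length ∧
      (∀ i, i < w.length → w.getD i 0 ≤ x (i + m)) ∧ Node e w) (by simpa using hcon) (by
    intro t ht
    by_contra! hc
    choose N hN using hc
    obtain ⟨w, h1, h2, h3, h4⟩ := ht (t.length + 1 +
      ∑ c ∈ Finset.range (x (t.length + m) + 1), N c)
    have h5 := h3 t.length (by omega)
    refine hN (w.getD t.length 0) w ?_ ?_ h3 h4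
    · have h6 : t.length < w.length := by omega
      rw [List.length_append, List.length_singleton, List.take_add_one, h1]
      simp [h6]
    · refine le_trans ?_ (le_trans (Nat.le_add_left _ _) h2)
      exact Finset.single_le_sum (f := N) (fun _ _ => Nat.zero_le _)
        (Finset.mem_range.2 (by omega)))
  refine he g (branch_of_node fun n => ?_)
  obtain ⟨w, h1, -, -, h4⟩ := hg n 0
  rw [← h1]
  exact h4.take _

/-- The list coded by a natural number. -/
def listOf (v : ℕ) : List ℕ := (Encodable.decode v).getD []

theorem primrec_listOf : Primrec listOf := by
  unfold listOf
  fun_prop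

theorem listOf_injective : Function.Injective listOf := by
  intro a b h
  have h' : ∀ v, listOf v = Denumerable.ofNat (List ℕ) v := fun v => by simp [listOf]
  rw [h', h'] at h
  simpa using congrArg Encodable.encode h

@[simp] theorem listOf_encode (w : List ℕ) : listOf (Encodable.encode w) = w := by
  simp [listOf]

/-- `y` enumerates codes of longer and longer nodes of the `e`-th tree along a branch. -/
def Climbs (e : ℕ) (y : NN) : Prop :=
  ∀ n, (listOf (y (n + 1))).take (listOf (y n)).length = listOf (y n) ∧ Node e (listOf (y n))

theorem dl_climbs : Dl (fun (e : ℕ) y => Climbs e y) := by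
  have := primrec_listOf
  refine Dl.all (Dl.and ?_ ?_)
  · exact Dl.atom (fun k => k.2 + 2) (fun p : (ℕ × ℕ) × List ℕ => decide (
      (listOf (p.2.getD (p.1.2 + 1) 0)).take (listOf (p.2.getD p.1.2 0)).length =
        listOf (p.2.getD p.1.2 0))) (by fun_prop) (by fun_prop) (by
        intro k x
        simp only [decide_eq_true_iff, initSeg_getD, show k.2 < k.2 + 2 by omega,
          show k.2 + 1 < k.2 + 2 by omega, if_true])
  · refine (dl_node.read (fun k : ℕ × ℕ => k.2 + 1)
      (fun p => (p.1.1, listOf (p.2.getD p.1.2 0))) (by fun_prop) (by fun_prop)).of_iff ?_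
    intro k x
    simp only [initSeg_getD, Nat.lt_succ_self, if_true]

end Sets

section Diagonalization

/-- The complement of the `i`-th of the pairwise disjoint sets obtained by reducing, by
comparison of ranks, the lightface coanalytic sets with codes listed by `b`. -/
def Misses (b : List ℕ) (i : ℕ) (x : NN) : Prop :=
  HasBranch (Sect (b.getD i 0) x) ∨ ∃ j, j < b.length ∧
    ((j < i ∧ Simulates (Sect (b.getD j 0) x) (Sect (b.getD i 0) x) [] []) ∨
      (i < j ∧ ∃ a, Sect (b.getD i 0) x [a] ∧
        Simulates (Sect (b.getD j 0) x) (Sect (b.getD i 0) x) [] [a]))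

theorem misses_or_misses_of_lt {b : List ℕ} {i j : ℕ} (hj : j < b.length) (hij : i < j)
    (x : NN) : Misses b i x ∨ Misses b j x := by
  by_cases h : HasBranch (Sect (b.getD j 0) x)
  · exact .inr (.inl h)
  · rcases simulates_or_of_not_hasBranch (S := Sect (b.getD i 0) x) h with h | h
    · exact .inr (.inr ⟨i, hij.trans hj, .inl ⟨hij, h⟩⟩)
    · exact .inl (.inr ⟨j, hj, .inr ⟨hij, h⟩⟩)

theorem misses_or_misses {b : List ℕ} {i j : ℕ} (hi : i < b.length) (hj : j < b.length)
    (hij : i ≠ j) (x : NN) : Misses b i x ∨ Misses b j x := by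
  rcases lt_or_gt_of_ne hij with h | h
  · exact misses_or_misses_of_lt hj h x
  · exact (misses_or_misses_of_lt hi h x).symm

theorem not_misses {b : List ℕ} {i : ℕ} {x : NN} (hi : ¬ HasBranch (Sect (b.getD i 0) x))
    (h : ∀ j < b.length, j ≠ i → HasBranch (Sect (b.getD j 0) x)) : ¬ Misses b i x := by
  rintro (h' | ⟨j, hj, ⟨hji, hs⟩ | ⟨hij, a, ha, hs⟩⟩)
  · exact hi h'
  · exact hi ((h j hj hji.ne).of_simulates hs)
  · exact hi ((h j hj hij.ne').of_simulates_singleton ha hs)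

theorem sig_misses : Sig (fun (k : List ℕ × ℕ) x => Misses k.1 k.2 x) := by
  have hlen : Sig (fun (k : (List ℕ × ℕ) × ℕ) _ => k.2 < k.1.1.length) :=
    Sig.atom (fun _ => 0) (fun p => decide (p.1.2 < p.1.1.1.length)) (by fun_prop)
      (by fun_prop) (fun k x => decide_eq_true_iff.symm)
  have hlt : Sig (fun (k : (List ℕ × ℕ) × ℕ) _ => k.2 < k.1.2) :=
    Sig.atom (fun _ => 0) (fun p => decide (p.1.2 < p.1.1.2)) (by fun_prop)
      (by fun_prop) (fun k x => decide_eq_true_iff.symm)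
  have hgt : Sig (fun (k : (List ℕ × ℕ) × ℕ) _ => k.1.2 < k.2) :=
    Sig.atom (fun _ => 0) (fun p => decide (p.1.1.2 < p.1.2)) (by fun_prop)
      (by fun_prop) (fun k x => decide_eq_true_iff.symm)
  have hs := sig_simulates.comp (g := fun k : (List ℕ × ℕ) × ℕ =>
    ((k.1.1.getD k.2 0, k.1.1.getD k.1.2 0), ([] : List ℕ))) (by fun_prop)
  have hsim := sig_simulates.comp (g := fun k : ((List ℕ × ℕ) × ℕ) × ℕ =>
    ((k.1.1.1.getD k.1.2 0, k.1.1.1.getD k.1.1.2 0), [k.2])) (by fun_prop)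
  have ha := dl_sect.1.comp (g := fun k : ((List ℕ × ℕ) × ℕ) × ℕ =>
    (k.1.1.1.getD k.1.1.2 0, [k.2])) (by fun_prop)
  exact (sig_hasBranch.comp (g := fun k : List ℕ × ℕ => k.1.getD k.2 0) (by fun_prop)).or
    (Sig.ex (hlen.and ((hlt.and hs).or (hgt.and (Sig.ex (ha.and hsim))))))

/-- No finite list of lightface coanalytic sets, once reduced, colors the restriction of the
shift graph to the sequences escaping the `e`-th tree. -/
def Uncolored (e : ℕ) : Prop :=
  ∀ b : List ℕ, ∃ x : NN, (StrictMono x ∧ Escapes e x) ∧ ∀ i j,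
    (i < b.length ∧ j < b.length ∧ i ≠ j) →
      Misses b i x ∨ Misses b j (fun n => x (n + 1))

theorem sig_uncolored : Sig (fun (e : ℕ) _ => Uncolored e) := by
  have h1 : Dl (fun (k : (List ℕ × ℕ) × ℕ) _ =>
      k.1.2 < k.1.1.length ∧ k.2 < k.1.1.length ∧ k.1.2 ≠ k.2) :=
    Dl.atom (fun _ => 0) (fun p => decide (p.1.1.2 < p.1.1.1.length) &&
      (decide (p.1.2 < p.1.1.1.length) && !(decide (p.1.1.2 = p.1.2)))) (by fun_prop)
      (by fun_prop) (by simp)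
  have h2 := sig_misses.comp (g := fun k : (List ℕ × ℕ) × ℕ => (k.1.1, k.1.2)) (by fun_prop)
  have h3 := (sig_misses.comp (g := fun k : (List ℕ × ℕ) × ℕ => (k.1.1, k.2))
    (by fun_prop)).comp_succ
  have h4 : Sig (fun (b : List ℕ) x => ∀ i j, (i < b.length ∧ j < b.length ∧ i ≠ j) →
      Misses b i x ∨ Misses b j (fun n => x (n + 1))) :=
    Sig.all (Sig.all ((h1.not.1.or (h2.or h3)).of_iff fun _ _ => imp_iff_not_or))
  have h5 := (dl_strictMono.1.and (dl_escapes.1.comp (g := fun k : ℕ × List ℕ => k.1)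
    (by fun_prop))).and (h4.comp (g := fun k : ℕ × List ℕ => k.2) (by fun_prop))
  exact Sig.all (Sig.ex_real (h5.comp_real (h := fun v => v.unpair.2) (by fun_prop)))

/-- A tree with a branch if and only if the sequences escaping it form an uncolored set. -/
theorem exists_branch_iff_uncolored : ∃ e, (∃ g, Branch e g) ↔ Uncolored e := by
  obtain ⟨f, hf, H⟩ := sig_uncolored
  obtain ⟨e, he⟩ := exists_passes_iff_self
    (F := fun p => f (p.1, p.2.map fun v => Nat.pair 0 v.unpair.2))
    (hf.comp (Primrec.to_comp (by fun_prop)))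
  refine ⟨e, ?_⟩
  refine Iff.trans ?_ (H e 0).symm
  constructor
  · rintro ⟨g, -, hg⟩
    refine ⟨fun n => (g n).unpair.2, fun n => ?_⟩
    have := (he _).1 (hg n)
    rwa [map_initSeg] at this
  · rintro ⟨y, hy⟩
    obtain ⟨g, hg⟩ := exists_seq_of_step (P := fun t c => (∀ v ∈ t, v < c) ∧
        (Nat.unpair c).2 = y t.length) fun t => ⟨Nat.pair (t.sum + 1) (y t.length),
      fun v hv => (Nat.lt_succ_of_le (List.single_le_sum (by simp) v hv)).trans_le
        (Nat.left_le_pair _ _), by simp⟩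
    refine ⟨g, strictMono_nat_of_lt_succ fun k => (hg (k + 1)).1 _ (by simp [initSeg_succ]),
      fun n => (he _).2 ?_⟩
    rw [map_initSeg]
    have e : (fun i => Nat.pair 0 (g i).unpair.2) = join 0 y := by
      funext i
      simpa [join] using (hg i).2
    rw [e]
    exact hy n

instance : PolishSpace IncSeq := by
  refine IsClosed.polishSpace (s := {x : NN | StrictMono x}) ?_
  have : {x : NN | StrictMono x} = ⋂ n, {x : NN | x n < x (n + 1)} := by
    ext x
    simp only [mem_iInter]
    exact ⟨fun h n => h (Nat.lt_succ_self n), fun h => strictMono_nat_of_lt_succ h⟩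
  rw [this]
  refine isClosed_iInter fun n => ?_
  exact (isClosed_discrete {p : ℕ × ℕ | p.1 < p.2}).preimage
    (f := fun x : NN => (x n, x (n + 1))) (by fun_prop)

theorem Sig.analyticSet {α : Type} [Primcodable α] {R : α → NN → Prop} (hR : Sig R) (k : α) :
    AnalyticSet {x : IncSeq | R k x.1} := by
  obtain ⟨f, hf, H⟩ := hR
  have h1 : IsClosed {p : NN × NN | ∀ n, f (k, initSeg (join p.1 p.2) n) = true} := by
    have : {p : NN × NN | ∀ n, f (k, initSeg (join p.1 p.2) n) = true} =
        ⋂ n, {p : NN × NN | f (k, initSeg (join p.1 p.2) n) = true} := by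
      ext
      simp
    rw [this]
    refine isClosed_iInter fun n => ?_
    have hc : Continuous fun (p : NN × NN) (i : Fin n) => (p.1 i, p.2 i) := by fun_prop
    have he : {p : NN × NN | f (k, initSeg (join p.1 p.2) n) = true} =
        (fun (p : NN × NN) (i : Fin n) => (p.1 i, p.2 i)) ⁻¹'
          {q | f (k, List.ofFn fun i => Nat.pair (q i).1 (q i).2) = true} := by
      ext p
      have : initSeg (join p.1 p.2) n = List.ofFn fun i : Fin n => Nat.pair (p.1 i) (p.2 i) := by
        simp [initSeg, List.ofFn_eq_map, ← List.map_coe_finRange_eq_range, Function.comp_def, join]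
      simp [this]
    rw [he]
    exact (isClosed_discrete _).preimage hc
  have h2 : AnalyticSet {x : NN | R k x} := by
    convert h1.analyticSet.image_of_continuous continuous_fst using 1
    ext x
    simp [H]
  exact h2.preimage continuous_subtype_val

theorem exists_uncolored_branch : ∃ e, (∃ g, Branch e g) ∧ Uncolored e := by
  classical
  obtain ⟨e, he⟩ := exists_branch_iff_uncolored
  suffices h : ∃ g, Branch e g from ⟨e, h, he.1 h⟩
  by_contra hcon
  have hE := escapes_of_forall_not_branch (not_exists.1 hcon)
  rw [he, Uncolored] at hcon
  push Not at hcon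
  obtain ⟨b, hb⟩ := hcon
  have hcol : ∀ x : IncSeq, ∃ i j, (i < b.length ∧ j < b.length ∧ i ≠ j) ∧
      ¬ Misses b i x.1 ∧ ¬ Misses b j (shift x).1 := fun x => hb x.1 ⟨x.2, hE x.1⟩
  have hex : ∀ x : IncSeq, ∃ i : Fin b.length, ¬ Misses b i x.1 := fun x => by
    obtain ⟨i, -, ⟨hi, -, -⟩, h, -⟩ := hcol x
    exact ⟨⟨i, hi⟩, h⟩
  choose c hc using hex
  have huniq : ∀ x : IncSeq, ∀ i (hi : i < b.length), ¬ Misses b i x.1 → c x = ⟨i, hi⟩ := by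
    intro x i hi h
    by_contra hne
    rcases misses_or_misses (c x).2 hi (fun h => hne (Fin.ext h)) x.1 with h' | h'
    · exact hc x h'
    · exact h h'
  have han : ∀ i : Fin b.length, AnalyticSet {x : IncSeq | Misses b i x.1} := fun i =>
    sig_misses.analyticSet (b, (i : ℕ))
  have hcompl : ∀ i : Fin b.length, {x : IncSeq | Misses b i x.1}ᶜ =
      ⋂ j : Fin b.length, if j = i then univ else {x : IncSeq | Misses b j x.1} := by
    intro i
    ext x
    simp only [mem_compl_iff, mem_iInter]
    constructor
    · intro h j
      split_ifs with hj
      · trivial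
      · by_contra hm
        exact hj ((huniq x j j.2 hm).symm.trans (huniq x i i.2 h))
    · intro h
      have := h (c x)
      split_ifs at this with hi
      · rw [← hi]
        exact hc x
      · exact absurd this (hc x)
  have hmeas : Measurable c := by
    refine measurable_to_countable' fun i => ?_
    have e : c ⁻¹' {i} = {x : IncSeq | Misses b i x.1}ᶜ := by
      ext x
      constructor
      · rintro rfl
        exact hc x
      · exact huniq x i i.2
    rw [e]
    refine ((han i).measurableSet_of_compl ?_).compl
    rw [hcompl]
    have : Nonempty (Fin b.length) := ⟨i⟩
    refine AnalyticSet.iInter fun j => ?_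
    split_ifs
    · exact MeasurableSet.univ.analyticSet
    · exact han j
  obtain ⟨x, hx⟩ := not_exists_measurable_coloring c hmeas
  obtain ⟨i, j, ⟨hi, hj, hij⟩, h1, h2⟩ := hcol x
  rw [huniq x i hi h1, huniq _ j hj h2] at hx
  exact hij (Fin.mk.inj hx)

theorem shiftEdge_shift (x : IncSeq) : shiftEdge x (shift x) := by
  refine ⟨fun h => ?_, .inl rfl⟩
  exact (x.2 Nat.zero_lt_one).ne (congrFun (congrArg Subtype.val h) 0)

theorem Uncolored.not_deltaColoringLE {e : ℕ} (he : Uncolored e) (n : ℕ) :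
    ¬ DeltaColoringLE {x | Escapes e x.1} n := by
  rintro ⟨A, hA, hcov, hind⟩
  have hsig : ∀ i, Sig (fun (_ : Unit) x => x ∈ Subtype.val '' (A i)ᶜ ∨
      ∃ j, j < i ∧ x ∈ Subtype.val '' (A j)) := fun i => by
    refine (sigmaLight_iff.1 (hA i).2).or (Sig.exists_fin fun j => ?_)
    refine Sig.and (Sig.atom (fun _ => 0) (fun _ => decide (j < i)) (by fun_prop)
      (by fun_prop) (by simp)) (sigmaLight_iff.1 (hA j).1)
  choose b hb using fun i => exists_hasBranch_iff (hsig i)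
  have hget : ∀ i : Fin n, (List.ofFn b).getD i 0 = b i := fun i => by simp
  have hmiss : ∀ x : IncSeq, Escapes e x.1 →
      ∃ i, x ∈ A i ∧ ¬ Misses (List.ofFn b) (i : Fin n) x.1 := by
    intro x hx
    obtain ⟨i, hi, hmin⟩ := WellFounded.has_min (wellFounded_lt (α := Fin n))
      {i | x ∈ A i} (mem_iUnion.1 (hcov hx))
    refine ⟨i, hi, not_misses ?_ fun j hj hji => ?_⟩
    · rw [hget, ← hb]
      rintro (⟨x', h, hxx⟩ | ⟨j, hj, x', h, hxx⟩)
      · exact h (Subtype.ext hxx ▸ hi)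
      · exact hmin j (Subtype.ext hxx ▸ h) hj
    · rw [List.length_ofFn] at hj
      have h1 := hget ⟨j, hj⟩
      simp only at h1
      rw [h1, ← hb]
      rcases lt_or_gt_of_ne hji with h | h
      · exact .inl ⟨x, fun hm => hmin ⟨j, hj⟩ hm h, rfl⟩
      · exact .inr ⟨i, h, x, hi, rfl⟩
  obtain ⟨x, ⟨hx, hE⟩, h⟩ := he (List.ofFn b)
  obtain ⟨i, hi, hmi⟩ := hmiss ⟨x, hx⟩ hE
  obtain ⟨j, hj, hmj⟩ := hmiss (shift ⟨x, hx⟩) hE.shift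
  have hij : i ≠ j := by
    rintro rfl
    exact hind i _ ⟨hi, hE⟩ _ ⟨hj, hE.shift⟩ (shiftEdge_shift _)
  rcases h i j (by simpa using fun h => hij (Fin.ext h)) with h | h
  · exact hmi h
  · exact hmj h

end Diagonalization

section Climbing

theorem Climbs.shift {e : ℕ} {y : NN} (h : Climbs e y) : Climbs e (fun n => y (n + 1)) :=
  fun n => h (n + 1)

theorem Climbs.exists_branch {e : ℕ} {y : NN} (h : Climbs e y) (hy : StrictMono y) :
    ∃ g, Branch e g ∧ ∀ n, ∃ l, n ≤ l ∧ listOf (y n) = initSeg g l := by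
  have hlen : StrictMono fun n => (listOf (y n)).length := by
    refine strictMono_nat_of_lt_succ fun n => ?_
    have h1 := (h n).1
    refine lt_of_le_of_ne (by rw [← h1, List.length_take]; exact min_le_right _ _) fun he => ?_
    rw [he, List.take_length] at h1
    exact (hy (Nat.lt_succ_self n)).ne (listOf_injective h1).symm
  have hget : ∀ n m, n ≤ m → ∀ i < (listOf (y n)).length,
      (listOf (y m)).getD i 0 = (listOf (y n)).getD i 0 := by
    intro n m hnm
    induction m, hnm using Nat.le_induction with
    | base => exact fun _ _ => rfl
    | succ m hnm ih =>
      intro i hi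
      rw [← ih i hi, ← (h m).1]
      have : i < (listOf (y m)).length := hi.trans_le (hlen.monotone hnm)
      simp [this]
  have hseg : ∀ n, listOf (y n) =
      initSeg (fun i => (listOf (y (i + 1))).getD i 0) (listOf (y n)).length := by
    intro n
    refine List.ext_getElem (by simp) fun i hi _ => ?_
    have e1 : (listOf (y n))[i] = (listOf (y n)).getD i 0 := by simp [hi]
    have hi' : i < (listOf (y (i + 1))).length := hlen.le_apply (x := i + 1)
    rw [e1]
    simp only [initSeg, List.getElem_map, List.getElem_range]
    rcases le_total n (i + 1) with hn | hn
    · exact (hget n _ hn i hi).symm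
    · exact hget _ n hn i hi'
  refine ⟨_, branch_of_node fun n => ?_, fun n => ⟨_, hlen.le_apply (x := n), hseg n⟩⟩
  have hn := ((h n).2).take n
  rw [hseg n, take_initSeg _ (hlen.le_apply (x := n))] at hn
  exact hn

theorem Branch.not_borelColoringLE {e : ℕ} {g : NN} (hg : Branch e g) (n : ℕ) :
    ¬ BorelColoringLE {y | Climbs e y.1} n := by
  rintro ⟨c, hc, hcol⟩
  have hinj : Function.Injective fun k => Encodable.encode (initSeg g k) := fun a b h => by
    simpa using congrArg List.length (Encodable.encode_injective h)
  obtain ⟨l, hl, hmono⟩ := Filter.strictMono_subseq_of_tendsto_atTop hinj.nat_tendsto_atTop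
  let Φ : IncSeq → {y : IncSeq | Climbs e y.1} := fun x =>
    ⟨⟨fun k => Encodable.encode (initSeg g (l (x.1 k))), fun _ _ h => hmono (x.2 h)⟩, fun k => by
      simp only [listOf_encode, length_initSeg]
      exact ⟨take_initSeg _ (hl.monotone (x.2 (Nat.lt_succ_self k)).le), hg.node _⟩⟩
  have hΦ : Measurable Φ := by
    refine Measurable.subtype_mk (Measurable.subtype_mk (measurable_pi_lambda _ fun k => ?_))
    exact (measurable_from_top (f := fun v : ℕ => Encodable.encode (initSeg g (l v)))).comp
      ((measurable_pi_apply k).comp measurable_subtype_coe)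
  obtain ⟨x, hx⟩ := not_exists_measurable_coloring _ (hc.comp hΦ)
  exact hcol (Φ x) (Φ (_root_.shift x)) (shiftEdge_shift (Φ x).1) hx

theorem apply_zero_ne_of_shiftEdge {x y : IncSeq} (h : shiftEdge x y) : x.1 0 ≠ y.1 0 := by
  rcases h.2 with rfl | rfl
  · exact (x.2 Nat.zero_lt_one).ne
  · exact (y.2 Nat.zero_lt_one).ne'

end Climbing

section Product

/-- Some entry of a list coded by `y` lies in the interval `(a, b]`. -/
def Separates (y : NN) (a b : ℕ) : Prop :=
  ∃ n i, i < (listOf (y n)).length ∧ a < (listOf (y n)).getD i 0 ∧ (listOf (y n)).getD i 0 ≤ b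

theorem separates_iff {g y : NN} (h : ∀ n, ∃ l, n ≤ l ∧ listOf (y n) = initSeg g l) (a b : ℕ) :
    Separates y a b ↔ ∃ i, a < g i ∧ g i ≤ b := by
  constructor
  · rintro ⟨n, i, hi, h1, h2⟩
    obtain ⟨l, -, hl⟩ := h n
    rw [hl, length_initSeg] at hi
    rw [hl, initSeg_getD, if_pos hi] at h1 h2
    exact ⟨i, h1, h2⟩
  · rintro ⟨i, h1, h2⟩
    obtain ⟨l, hil, hl⟩ := h (i + 1)
    refine ⟨i + 1, i, ?_⟩
    rw [hl, length_initSeg, initSeg_getD, if_pos (Nat.lt_of_succ_le hil)]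
    exact ⟨hil, h1, h2⟩

theorem separates_shift {e : ℕ} {y : NN} (h : Climbs e y) (hy : StrictMono y) :
    Separates (fun n => y (n + 1)) = Separates y := by
  obtain ⟨g, -, hg⟩ := h.exists_branch hy
  funext a b
  rw [separates_iff hg, separates_iff (g := g)]
  intro n
  obtain ⟨l, hl, h⟩ := hg (n + 1)
  exact ⟨l, (Nat.le_succ n).trans hl, h⟩

/-- `x n` and `x (n + 1)` are not separated by `y`, but `x (n + 1)` and `x (n + 2)` are. -/
def Turns (x y : NN) (n : ℕ) : Prop :=
  ¬ Separates y (x n) (x (n + 1)) ∧ Separates y (x (n + 1)) (x (n + 2))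

theorem exists_turns {e : ℕ} {x y : NN} (hx : StrictMono x) (hxe : Escapes e x)
    (hy : StrictMono y) (hye : Climbs e y) : ∃ n, Turns x y n := by
  obtain ⟨g, hg, hgy⟩ := hye.exists_branch hy
  by_contra! hcon
  simp only [Turns, not_and, separates_iff hgy] at hcon
  by_cases hall : ∀ n, ∃ i, x n < g i ∧ g i ≤ x (n + 1)
  · obtain ⟨n, hn⟩ := hxe.exists_lt hg (g 0)
    refine hn.not_ge ?_
    clear hn
    induction n with
    | zero => simpa using hx.le_apply (x := g 0)
    | succ n ih =>
      obtain ⟨i, hi, hi'⟩ := hall (n + g 0)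
      have : n < i := hg.1.lt_iff_lt.1 (ih.trans_lt hi)
      rw [Nat.add_right_comm]
      exact (hg.1.monotone this).trans hi'
  · push Not at hall
    obtain ⟨n₀, h₀⟩ := hall
    obtain ⟨i, hi⟩ : ∃ i, x n₀ < g i := ⟨x n₀ + 1, hg.1.le_apply (x := x n₀ + 1)⟩
    have hnext : ∀ n, n₀ ≤ n → (¬ ∃ i, x n < g i ∧ g i ≤ x (n + 1)) ∧ x n < g i := by
      intro n hn
      induction n, hn using Nat.le_induction with
      | base => exact ⟨by push Not; exact h₀, hi⟩
      | succ n _ ih => exact ⟨hcon n ih.1, not_le.1 fun h => ih.1 ⟨i, ih.2, h⟩⟩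
    have h1 := (hnext (max n₀ (g i)) (le_max_left _ _)).2
    exact h1.not_ge ((le_max_right _ _).trans hx.le_apply)

/-- The first element of `P` exists and is even. -/
def FirstEven (P : ℕ → Prop) : Prop := ∃ n, P n ∧ (∀ m, m < n → ¬ P m) ∧ n % 2 = 0

theorem firstEven_succ_iff {P : ℕ → Prop} (h0 : ¬ P 0) (h : ∃ n, P (n + 1)) :
    FirstEven (fun n => P (n + 1)) ↔ ¬ FirstEven P := by
  classical
  have hP : ∃ n, P n := let ⟨n, hn⟩ := h; ⟨_, hn⟩
  have key : ∀ {Q : ℕ → Prop} (hQ : ∃ n, Q n), FirstEven Q ↔ Nat.find hQ % 2 = 0 := by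
    intro Q hQ
    constructor
    · rintro ⟨n, h1, h2, h3⟩
      rwa [(Nat.find_eq_iff hQ).2 ⟨h1, fun m hm => h2 m hm⟩]
    · exact fun h => ⟨_, Nat.find_spec hQ, fun m hm => Nat.find_min hQ hm, h⟩
  rw [key h, key hP, Nat.find_comp_succ hP h h0]
  omega

/-- The colors used on the product graph. -/
def productColor : Fin 3 → Set (IncSeq × IncSeq) :=
  ![{p | ¬ Turns p.1.1 p.2.1 0 ∧ FirstEven (Turns p.1.1 p.2.1)},
    {p | ¬ Turns p.1.1 p.2.1 0 ∧ ¬ FirstEven (Turns p.1.1 p.2.1)},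
    {p | Turns p.1.1 p.2.1 0}]

theorem dl_turns : Dl (fun (n : ℕ) z =>
    Turns (fun i => (z i).unpair.1) (fun i => (z i).unpair.2) n) := by
  have := primrec_listOf
  have h1 : Dl (fun (k : ((ℕ × ℕ) × ℕ) × ℕ) y => k.2 < (listOf (y k.1.2)).length ∧
      k.1.1.1 < (listOf (y k.1.2)).getD k.2 0 ∧ (listOf (y k.1.2)).getD k.2 0 ≤ k.1.1.2) := by
    refine Dl.and ?_ (Dl.and ?_ ?_)
    · exact (Dl.atom (α := ℕ × ℕ) (fun k => k.1 + 1) (fun p => decide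
        (p.1.2 < (listOf (p.2.getD p.1.1 0)).length)) (by fun_prop) (by fun_prop)
        (R := fun k y => k.2 < (listOf (y k.1)).length) (by
          intro k x
          rw [decide_eq_true_iff, initSeg_getD, if_pos (Nat.lt_succ_self _)])).comp
        (g := fun k : ((ℕ × ℕ) × ℕ) × ℕ => (k.1.2, k.2)) (by fun_prop)
    · exact (Dl.atom (α := (ℕ × ℕ) × ℕ) (fun k => k.1.1 + 1) (fun p => decide
        (p.1.2 < (listOf (p.2.getD p.1.1.1 0)).getD p.1.1.2 0)) (by fun_prop) (by fun_prop)
        (R := fun k y => k.2 < (listOf (y k.1.1)).getD k.1.2 0) (by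
          intro k x
          rw [decide_eq_true_iff, initSeg_getD, if_pos (Nat.lt_succ_self _)])).comp
        (g := fun k : ((ℕ × ℕ) × ℕ) × ℕ => ((k.1.2, k.2), k.1.1.1)) (by fun_prop)
    · exact (Dl.atom (α := (ℕ × ℕ) × ℕ) (fun k => k.1.1 + 1) (fun p => decide
        ((listOf (p.2.getD p.1.1.1 0)).getD p.1.1.2 0 < p.1.2 + 1)) (by fun_prop) (by fun_prop)
        (R := fun k y => (listOf (y k.1.1)).getD k.1.2 0 ≤ k.2) (by
          intro k x
          rw [decide_eq_true_iff, initSeg_getD, if_pos (Nat.lt_succ_self _),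
            Nat.lt_succ_iff])).comp
        (g := fun k : ((ℕ × ℕ) × ℕ) × ℕ => ((k.1.2, k.2), k.1.1.2)) (by fun_prop)
  have h2 : Dl (fun (k : ℕ × ℕ) y => Separates y k.1 k.2) := Dl.ex (Dl.ex h1)
  have h3 : Dl (fun (n : ℕ) z => Separates (fun i => (z i).unpair.2) (z n).unpair.1
      (z (n + 1)).unpair.1) := by
    refine ((h2.comp_real (h := fun v => v.unpair.2) (by fun_prop)).read (fun n : ℕ => n + 2)
      (fun p => ((p.2.getD p.1 0).unpair.1, (p.2.getD (p.1 + 1) 0).unpair.1)) (by fun_prop)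
      (by fun_prop)).of_iff fun n z => ?_
    simp only [initSeg_getD, show n < n + 2 by omega, show n + 1 < n + 2 by omega, if_true]
  exact h3.not.and (h3.comp (g := fun n => n + 1) (by fun_prop))

theorem lightDelta11P_productColor (i : Fin 3) : LightDelta11P (productColor i) := by
  have h0 := dl_turns.comp (g := fun _ : Unit => 0) (by fun_prop)
  have h1 : Dl (fun (k : Unit × ℕ) _ => k.2 % 2 = 0) :=
    Dl.atom (fun _ => 0) (fun p => decide (p.1.2 % 2 = 0)) (by fun_prop)
      (PrimrecRule.decide_eq (Primrec.nat_mod.comp (by fun_prop) (by fun_prop)) (by fun_prop))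
      (fun k x => decide_eq_true_iff.symm)
  have h2 : Dl (fun (k : (Unit × ℕ) × ℕ) _ => k.2 < k.1.2) :=
    Dl.atom (fun _ => 0) (fun p => decide (p.1.2 < p.1.1.2)) (by fun_prop)
      (by fun_prop) (fun k x => decide_eq_true_iff.symm)
  have h3 := dl_turns.comp (g := fun k : Unit × ℕ => k.2) (by fun_prop)
  have h4 := dl_turns.comp (g := fun k : (Unit × ℕ) × ℕ => k.2) (by fun_prop)
  have h5 : Dl (fun (_ : Unit) z =>
      FirstEven (Turns (fun i => (z i).unpair.1) (fun i => (z i).unpair.2))) :=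
    Dl.ex (h3.and ((Dl.all (h2.imp h4.not)).and h1))
  fin_cases i
  · exact lightDelta11P_of_dl (P := fun x y => ¬ Turns x y 0 ∧ FirstEven (Turns x y))
      (h0.not.and h5)
  · exact lightDelta11P_of_dl (P := fun x y => ¬ Turns x y 0 ∧ ¬ FirstEven (Turns x y))
      (h0.not.and h5.not)
  · exact lightDelta11P_of_dl (P := fun x y => Turns x y 0) h0

theorem iUnion_productColor : ⋃ i, productColor i = univ := by
  refine eq_univ_of_forall fun p => mem_iUnion.2 ?_
  by_cases h0 : Turns p.1.1 p.2.1 0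
  · exact ⟨2, h0⟩
  · by_cases h1 : FirstEven (Turns p.1.1 p.2.1)
    · exact ⟨0, h0, h1⟩
    · exact ⟨1, h0, h1⟩

theorem disjoint_productColor_shift {e : ℕ} {p q : IncSeq × IncSeq} (hp : Escapes e p.1.1)
    (hp' : Climbs e p.2.1) (hq' : Climbs e q.2.1) (h : shift p.1 = q.1)
    (h' : shift p.2 = q.2 ∨ shift q.2 = p.2) (i : Fin 3) :
    ¬ (p ∈ productColor i ∧ q ∈ productColor i) := by
  have hsep : Separates q.2.1 = Separates p.2.1 := by
    rcases h' with h' | h'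
    · rw [← h']
      exact separates_shift hp' p.2.2
    · rw [← h']
      exact (separates_shift hq' q.2.2).symm
  have hturn : Turns q.1.1 q.2.1 = fun n => Turns p.1.1 p.2.1 (n + 1) := by
    funext n
    rw [← h, Turns, hsep]
    rfl
  have hq : Escapes e q.1.1 := h ▸ hp.shift
  have hex : ∃ n, Turns p.1.1 p.2.1 (n + 1) := by
    obtain ⟨n, hn⟩ := exists_turns q.1.2 hq q.2.2 hq'
    rw [hturn] at hn
    exact ⟨n, hn⟩
  rintro ⟨h1, h2⟩
  fin_cases i
  · exact (firstEven_succ_iff h1.1 hex).1 (hturn ▸ h2.2) h1.2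
  · exact h2.2 (hturn ▸ (firstEven_succ_iff h1.1 hex).2 h1.2)
  · have h3 : Turns q.1.1 q.2.1 0 := h2
    rw [hturn] at h3
    exact h3.1 h1.2

end Product

/-- A counterexample to the `Δ¹₁` version of Hedetniemi's conjecture: there are `Δ¹₁`
sets `B, C ⊆ [ℕ]^ℕ` with `χ_B(G_S|_C) = ℵ₀` (no finite Borel coloring, but a countable
one), `G_S|_B` admitting no finite `Δ¹₁` coloring, while the product graph
`G_S|_B × G_S|_C` admits a `Δ¹₁` `3`-coloring. -/
theorem delta11_Hedetniemi_counterexample :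
    ∃ B C : Set IncSeq, LightDelta11 B ∧ LightDelta11 C ∧
      (¬ ∃ n : ℕ, BorelColoringLE C n) ∧
      (∃ c : IncSeq → ℕ, Measurable c ∧ ∀ x ∈ C, ∀ y ∈ C, shiftEdge x y → c x ≠ c y) ∧
      (¬ ∃ n : ℕ, DeltaColoringLE B n) ∧
      (∃ A : Fin 3 → Set (IncSeq × IncSeq), (∀ i, LightDelta11P (A i)) ∧
        (B ×ˢ C) ⊆ (⋃ i, A i) ∧
        ∀ i, ∀ p ∈ A i ∩ (B ×ˢ C), ∀ q ∈ A i ∩ (B ×ˢ C),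
          ¬ (shiftEdge p.1 q.1 ∧ shiftEdge p.2 q.2)) := by
  obtain ⟨e, ⟨g, hg⟩, he⟩ := exists_uncolored_branch
  refine ⟨{x | Escapes e x.1}, {y | Climbs e y.1},
    lightDelta11_of_dl (dl_escapes.comp (g := fun _ : Unit => e) (by fun_prop)),
    lightDelta11_of_dl (dl_climbs.comp (g := fun _ : Unit => e) (by fun_prop)),
    fun ⟨n, hn⟩ => hg.not_borelColoringLE n hn,
    ⟨fun x => x.1 0, (measurable_pi_apply 0).comp measurable_subtype_coe,
      fun x _ y _ h => apply_zero_ne_of_shiftEdge h⟩,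
    fun ⟨n, hn⟩ => he.not_deltaColoringLE n hn,
    productColor, lightDelta11P_productColor, ?_, ?_⟩
  · rw [iUnion_productColor]
    exact subset_univ _
  · rintro i p ⟨hpi, hp⟩ q ⟨hqi, hq⟩ ⟨⟨-, h1⟩, -, h2⟩
    rcases h1 with h1 | h1
    · exact disjoint_productColor_shift hp.1 hp.2 hq.2 h1 h2 i ⟨hpi, hqi⟩
    · exact disjoint_productColor_shift hq.1 hq.2 hp.2 h1 h2.symm i ⟨hqi, hpi⟩
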